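/- Let f: Σ → ℝ^d be continuous and let α ∈ L_f = {∫ f dμ : μ ∈ M(Σ,σ)}. Then the Hausdorff dimension of Π(X_α ∩ Σ̃) equals the supremum of h(μ,σ)/λ(μ,σ) over all μ ∈ M(Σ,σ) satisfying ∫ f dμ = α and λ(μ,σ) > 0, where X_α = {ω ∈ Σ : lim_{n→∞} A_n f(ω) = α}. -/

import Mathlib

open MeasureTheory Set Filter Topology

noncomputable section

/-- A finite measurable partition of the space. -/
def IsMeasPartition {X : Type*} [MeasurableSpace X] (P : Finset (Set X)) : Prop :=
  (∀ s ∈ P, MeasurableSet s) ∧ ((P : Set (Set X)).PairwiseDisjoint id) ∧ (⋃ s ∈ P, s) = univ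

/-- Shannon entropy of the refinement `⋁_{i<n} T^{-i} P` of a finite partition `P`
under the first `n` iterates of `T`, with respect to the measure `μ`. -/
def partEntropy {X : Type*} [MeasurableSpace X] (T : X → X) (μ : Measure X)
    (P : Finset (Set X)) (n : ℕ) : ℝ :=
  ∑ c : Fin n → {s // s ∈ P},
    Real.negMulLog (μ (⋂ i : Fin n, T^[(i : ℕ)] ⁻¹' ((c i : Set X)))).toReal

/-- The Kolmogorov–Sinai (metric) entropy of the measure `μ` for the map `T`:
the supremum over finite measurable partitions `P` of
`lim_n (1/n) H(⋁_{i<n} T^{-i}P)`, the limit being computed as an infimum (by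
subadditivity of the entropy sequence). -/
def metricEntropy {X : Type*} [MeasurableSpace X] (T : X → X) (μ : Measure X) : ℝ :=
  ⨆ P : {P : Finset (Set X) // IsMeasPartition P},
    ⨅ n : ℕ, partEntropy T μ (P : Finset (Set X)) (n + 1) / (n + 1)

/-- Birkhoff (ergodic) average `A_n f(x) = (1/n) ∑_{j<n} f(T^j x)`. -/
def birkhoff {X E : Type*} [AddCommMonoid E] [Module ℝ E]
    (T : X → X) (f : X → E) (n : ℕ) (x : X) : E :=
  (n : ℝ)⁻¹ • ∑ j ∈ Finset.range n, f (T^[j] x)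

/-- The full shift space `Σ = {1,…,m}^ℕ`. -/
abbrev SymbSp (m : ℕ) := ℕ → Fin m

/-- The shift map `σ` on `Σ`. -/
def shift {m : ℕ} (ω : SymbSp m) : SymbSp m := fun n => ω (n + 1)

/-- The set `M(Σ,σ)` of shift-invariant Borel probability measures on `Σ`. -/
def shiftInvMeasures (m : ℕ) : Set (Measure (SymbSp m)) :=
  {μ | IsProbabilityMeasure μ ∧ μ.map shift = μ}

/-- The level set `X_α = {ω ∈ Σ : lim_n A_n f(ω) = α}` of a potential `f` on `Σ`. -/
def symbLevelSet {m : ℕ} {E : Type*} [AddCommMonoid E] [Module ℝ E] [TopologicalSpace E]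
    (f : SymbSp m → E) (α : E) : Set (SymbSp m) :=
  {ω | Tendsto (fun n => birkhoff shift f n ω) atTop (𝓝 α)}

/-- A piecewise `C¹` expanding (possibly non-uniformly hyperbolic) interval map:
`m` pairwise non-overlapping subintervals `I 1, …, I m` of `[0,1]`, a map `T` which
restricted to each `I i` is a `C¹` surjection onto `[0,1]` (with derivative `T'`),
a unique fixed point `fixPt i` of `T` in each `I i`, and `T' > 1` away from the
fixed points. -/
structure PCSystem (m : ℕ) where
  hm : 0 < m
  I : Fin m → Set ℝ
  T : ℝ → ℝ
  T' : ℝ → ℝ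
  fixPt : Fin m → ℝ
  hI : ∀ i, ∃ a b : ℝ, a < b ∧ I i = Icc a b
  hIsub : ∀ i, I i ⊆ Icc 0 1
  hdisj : ∀ i j, i ≠ j → Disjoint (interior (I i)) (interior (I j))
  hTmeas : Measurable T
  hT'meas : Measurable T'
  hmapsto : ∀ i, MapsTo T (I i) (Icc 0 1)
  hsurj : ∀ i, SurjOn T (I i) (Icc 0 1)
  hderiv : ∀ i, ∀ x ∈ I i, HasDerivWithinAt T (T' x) (I i) x
  hT'cont : ∀ i, ContinuousOn T' (I i)
  hfixmem : ∀ i, fixPt i ∈ I i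
  hfix : ∀ i, T (fixPt i) = fixPt i
  hfixuniq : ∀ i, ∀ y ∈ I i, T y = y → y = fixPt i
  hexp : ∀ y ∈ ⋃ i, I i, y ∉ range fixPt → 1 < T' y

namespace PCSystem

variable {m : ℕ} (S : PCSystem m)

/-- The attractor `Λ = {x ∈ ⋃ I_i : T^n x ∈ [0,1] for all n}`. -/
def attractor : Set ℝ :=
  {x | (x ∈ ⋃ i, S.I i) ∧ ∀ n : ℕ, S.T^[n] x ∈ Icc (0:ℝ) 1}

/-- The basic interval `I_w = T_{w₁}∘⋯∘T_{wₙ}([0,1])` coded by the word `w`,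
described via the forward map: `I_{i·w} = I_i ∩ T⁻¹(I_w)`. -/
def cyl (S : PCSystem m) : List (Fin m) → Set ℝ
  | [] => Icc 0 1
  | i :: w => S.I i ∩ S.T ⁻¹' (cyl S w)

end PCSystem

/-- The word `ω₁…ωₙ` of the first `n` symbols of `ω`. -/
def word {m : ℕ} (ω : SymbSp m) (n : ℕ) : List (Fin m) := List.ofFn fun j : Fin n => ω j

namespace PCSystem

variable {m : ℕ} (S : PCSystem m)

/-- The coding map `Π : Σ → Λ`, `Π(ω) = lim_n T_{ω₁}∘⋯∘T_{ωₙ}([0,1])`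
(realized as the supremum of the nested intersection `⋂_n I_{ω|_n}`, which is
a single point). -/
def code (ω : SymbSp m) : ℝ := sSup (⋂ n : ℕ, S.cyl (word ω n))

/-- The geometric potential `g(ω) = −log T'_{ω₁}(Π(σω)) = log T'(Π(ω))`. -/
def g (ω : SymbSp m) : ℝ := Real.log (S.T' (S.code ω))

/-- `Σ̃ = {ω : liminf_n A_n g(ω) > 0}`. -/
def SigmaTilde : Set (SymbSp m) :=
  {ω | 0 < atTop.liminf fun n => birkhoff shift S.g n ω}

/-- The set `M(Λ,T)` of `T`-invariant Borel probability measures on the attractor `Λ`. -/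
def invMeasures : Set (Measure ℝ) :=
  {μ | IsProbabilityMeasure μ ∧ μ.map S.T = μ ∧ μ S.attractorᶜ = 0}

/-- Lyapunov exponent `λ(μ,T) = ∫ log|T'| dμ` of a measure on the attractor. -/
def lyap (μ : Measure ℝ) : ℝ := ∫ x, Real.log |S.T' x| ∂μ

/-- Lyapunov exponent `λ(μ,σ) = ∫ g dμ` of a measure on the shift space. -/
def lyapSymb (μ : Measure (SymbSp m)) : ℝ := ∫ ω, S.g ω ∂μ

/-- The set of parabolic fixed points, i.e. those fixed points `x_j` with `T'(x_j) = 1`. -/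
def parabolicSet : Set ℝ := {y | ∃ i, y = S.fixPt i ∧ S.T' y = 1}

/-- The level set `Λ_α = {x ∈ Λ : lim_n (1/n)∑_{j<n} F(T^j x) = α}`. -/
def levelSet {E : Type*} [AddCommMonoid E] [Module ℝ E] [TopologicalSpace E]
    (F : ℝ → E) (α : E) : Set ℝ :=
  {x | x ∈ S.attractor ∧ Tendsto (fun n => birkhoff S.T F n x) atTop (𝓝 α)}

/-- `Λ̃`: the set of points of the attractor having exactly two codings. -/
def doubleCoded : Set ℝ := {x | x ∈ S.attractor ∧ (S.code ⁻¹' {x}).ncard = 2}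

end PCSystem

namespace PCSystem

variable {m : ℕ} (S : PCSystem m)

lemma finF : (range S.fixPt).Finite := Set.finite_range _

lemma one_le_T' (i : Fin m) {x : ℝ} (hx : x ∈ S.I i) : 1 ≤ S.T' x := by
  by_contra hlt
  push Not at hlt
  obtain ⟨a, b, hab, hI⟩ := S.hI i
  have hc : ContinuousWithinAt S.T' (S.I i) x := S.hT'cont i x hx
  have h1 : ∀ᶠ y in 𝓝[S.I i] x, S.T' y < 1 := hc.eventually (gt_mem_nhds hlt)
  have h2 : range S.fixPt ∈ 𝓝[S.I i] x := by
    filter_upwards [h1, self_mem_nhdsWithin] with y hy hyI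
    by_contra hn
    exact absurd (S.hexp y (mem_iUnion.2 ⟨i, hyI⟩) hn) (by linarith)
  rw [hI] at h2 hx
  rcases lt_or_ge x b with hxb | hxb
  · have h3 : range S.fixPt ∈ 𝓝[>] x := by
      rw [← nhdsWithin_Ioo_eq_nhdsGT hxb]
      exact nhdsWithin_mono _ (show Ioo x b ⊆ Icc a b from fun y hy => ⟨hx.1.trans hy.1.le, hy.2.le⟩) h2
    obtain ⟨u, hu, hu2⟩ := (mem_nhdsGT_iff_exists_Ioo_subset).1 h3
    exact (Ioo_infinite hu) (S.finF.subset hu2)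
  · have hax : a < x := lt_of_lt_of_le hab hxb
    have h3 : range S.fixPt ∈ 𝓝[<] x := by
      rw [← nhdsWithin_Ioo_eq_nhdsLT hax]
      exact nhdsWithin_mono _ (show Ioo a x ⊆ Icc a b from fun y hy => ⟨hy.1.le, hy.2.le.trans hx.2⟩) h2
    obtain ⟨u, hu, hu2⟩ := (mem_nhdsLT_iff_exists_Ioo_subset).1 h3
    exact (Ioo_infinite hu) (S.finF.subset hu2)

lemma contT (i : Fin m) : ContinuousOn S.T (S.I i) := fun x hx =>
  (S.hderiv i x hx).continuousWithinAt

lemma hasDerivAt_T (i : Fin m) {x y z : ℝ} (hx : x ∈ S.I i) (hy : y ∈ S.I i) (hz : z ∈ Ioo x y) :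
    HasDerivAt S.T (S.T' z) z := by
  obtain ⟨a, b, hab, hI⟩ := S.hI i
  rw [hI] at hx hy
  have hn : S.I i ∈ 𝓝 z := by
    rw [hI]
    exact Icc_mem_nhds (hx.1.trans_lt hz.1) (hz.2.trans_le hy.2)
  exact (S.hderiv i z (mem_of_mem_nhds hn)).hasDerivAt hn

lemma Icc_sub (i : Fin m) {x y : ℝ} (hx : x ∈ S.I i) (hy : y ∈ S.I i) : Icc x y ⊆ S.I i := by
  obtain ⟨a, b, hab, hI⟩ := S.hI i
  rw [hI] at hx hy ⊢
  exact Icc_subset_Icc hx.1 hy.2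

lemma mvt (i : Fin m) {x y : ℝ} (hx : x ∈ S.I i) (hy : y ∈ S.I i) (hxy : x < y) :
    ∃ ξ ∈ Ioo x y, S.T y - S.T x = S.T' ξ * (y - x) := by
  obtain ⟨ξ, hξ, h⟩ := exists_hasDerivAt_eq_slope S.T S.T' hxy
    ((S.contT i).mono (S.Icc_sub i hx hy)) (fun z hz => S.hasDerivAt_T i hx hy hz)
  refine ⟨ξ, hξ, ?_⟩
  rw [h, div_mul_cancel₀]
  linarith

lemma exp_le (i : Fin m) {x y : ℝ} (hx : x ∈ S.I i) (hy : y ∈ S.I i) (hxy : x ≤ y) :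
    y - x ≤ S.T y - S.T x := by
  rcases hxy.eq_or_lt with rfl | hxy
  · simp
  obtain ⟨ξ, hξ, h⟩ := S.mvt i hx hy hxy
  have := S.one_le_T' i (S.Icc_sub i hx hy ⟨hξ.1.le, hξ.2.le⟩)
  rw [h]
  nlinarith

lemma exp_lt (i : Fin m) {x y : ℝ} (hx : x ∈ S.I i) (hy : y ∈ S.I i) (hxy : x < y) :
    y - x < S.T y - S.T x := by
  -- pick a point of `(x,y)` avoiding the fixed points
  obtain ⟨z, hz, hzF⟩ : ∃ z ∈ Ioo x y, z ∉ range S.fixPt := by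
    by_contra hcon
    push Not at hcon
    exact (Ioo_infinite hxy) (S.finF.subset hcon)
  by_contra hle
  push Not at hle
  have heq : ∀ w ∈ Icc x y, S.T w - w = S.T x - x := by
    intro w hw
    have hwI := S.Icc_sub i hx hy hw
    have h1 := S.exp_le i hx hwI hw.1
    have h2 := S.exp_le i hwI hy hw.2
    linarith
  have hd : HasDerivAt (fun w => S.T w - w) (S.T' z - 1) z :=
    (S.hasDerivAt_T i hx hy hz).sub (hasDerivAt_id z)
  have hd2 : HasDerivAt (fun w => S.T w - w) 0 z := by
    refine (hasDerivAt_const z (S.T x - x)).congr_of_eventuallyEq ?_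
    filter_upwards [Icc_mem_nhds hz.1 hz.2] with w hw using heq w hw
  have h3 := hd.unique hd2
  have h4 := S.hexp z (mem_iUnion.2 ⟨i, S.Icc_sub i hx hy ⟨hz.1.le, hz.2.le⟩⟩) hzF
  linarith

lemma strictMono (i : Fin m) : StrictMonoOn S.T (S.I i) := by
  intro x hx y hy hxy
  have := S.exp_le i hx hy hxy.le
  linarith

lemma T_ends (i : Fin m) : ∃ a b, a < b ∧ S.I i = Icc a b ∧ S.T a = 0 ∧ S.T b = 1 := by
  obtain ⟨a, b, hab, hI⟩ := S.hI i
  have ha : a ∈ S.I i := by rw [hI]; exact ⟨le_rfl, hab.le⟩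
  have hb : b ∈ S.I i := by rw [hI]; exact ⟨hab.le, le_rfl⟩
  refine ⟨a, b, hab, hI, ?_, ?_⟩
  · obtain ⟨x, hx, hx0⟩ := S.hsurj i (show (0:ℝ) ∈ Icc (0:ℝ) 1 by simp)
    have h1 : S.T a ≤ S.T x := (S.strictMono i).monotoneOn ha hx (by rw [hI] at hx; exact hx.1)
    exact le_antisymm (by linarith) (S.hmapsto i ha).1
  · obtain ⟨x, hx, hx0⟩ := S.hsurj i (show (1:ℝ) ∈ Icc (0:ℝ) 1 by simp)
    have h1 : S.T x ≤ S.T b := (S.strictMono i).monotoneOn hx hb (by rw [hI] at hx; exact hx.2)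
    exact le_antisymm (S.hmapsto i hb).2 (by linarith)

lemma I_disjoint {i j : Fin m} (hij : i ≠ j) : Disjoint (S.I i) (S.I j) := by
  rw [Set.disjoint_left]
  intro x hx hx'
  obtain ⟨a, b, hab, hI, ha, hb⟩ := S.T_ends i
  obtain ⟨a', b', hab', hI', ha', hb'⟩ := S.T_ends j
  have hd := S.hdisj i j hij
  rw [hI, hI', interior_Icc, interior_Icc, Set.disjoint_iff_inter_eq_empty, Ioo_inter_Ioo,
    Ioo_eq_empty_iff] at hd
  rw [hI] at hx
  rw [hI'] at hx'
  push Not at hd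
  rcases le_total a a' with h1 | h1 <;> rcases le_total b b' with h2 | h2
  · rw [sup_eq_right.2 h1, inf_eq_left.2 h2] at hd
    have e1 : x = b := le_antisymm hx.2 (hd.trans hx'.1)
    have e2 : x = a' := le_antisymm (hx.2.trans hd) hx'.1
    rw [← e1] at hb
    rw [← e2] at ha'
    linarith
  · rw [sup_eq_right.2 h1, inf_eq_right.2 h2] at hd
    linarith
  · rw [sup_eq_left.2 h1, inf_eq_left.2 h2] at hd
    linarith
  · rw [sup_eq_left.2 h1, inf_eq_right.2 h2] at hd
    have e1 : x = b' := le_antisymm hx'.2 (hd.trans hx.1)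
    have e2 : x = a := le_antisymm (hx'.2.trans hd) hx.1
    rw [← e1] at hb'
    rw [← e2] at ha
    linarith

def lo (w : List (Fin m)) : ℝ := sInf (S.cyl w)
def hi (w : List (Fin m)) : ℝ := sSup (S.cyl w)
def len (w : List (Fin m)) : ℝ := S.hi w - S.lo w

lemma lohi_of {w : List (Fin m)} {u v : ℝ} (h : u < v) (he : S.cyl w = Icc u v) :
    S.lo w = u ∧ S.hi w = v := by
  unfold lo hi
  rw [he, csInf_Icc h.le, csSup_Icc h.le]
  exact ⟨rfl, rfl⟩

lemma cyl_cons_aux (i : Fin m) (w : List (Fin m)) {u v : ℝ} (huv : u < v) (hu : 0 ≤ u)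
    (hv : v ≤ 1) (he : S.cyl w = Icc u v) :
    ∃ p q, p < q ∧ p ∈ S.I i ∧ q ∈ S.I i ∧ S.T p = u ∧ S.T q = v ∧
      S.cyl (i :: w) = Icc p q := by
  obtain ⟨p, hp, hpu⟩ := S.hsurj i (show u ∈ Icc (0:ℝ) 1 from ⟨hu, huv.le.trans hv⟩)
  obtain ⟨q, hq, hqv⟩ := S.hsurj i (show v ∈ Icc (0:ℝ) 1 from ⟨hu.trans huv.le, hv⟩)
  have hmono := S.strictMono i
  refine ⟨p, q, ?_, hp, hq, hpu, hqv, ?_⟩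
  · rw [← hmono.lt_iff_lt hp hq, hpu, hqv]; exact huv
  · ext x
    show x ∈ S.I i ∧ S.T x ∈ S.cyl w ↔ _
    rw [he]
    constructor
    · rintro ⟨hx, hx1, hx2⟩
      rw [← hpu, hmono.le_iff_le hp hx] at hx1
      rw [← hqv, hmono.le_iff_le hx hq] at hx2
      exact ⟨hx1, hx2⟩
    · intro hx
      have hxI := S.Icc_sub i hp hq hx
      refine ⟨hxI, ?_, ?_⟩
      · rw [← hpu, hmono.le_iff_le hp hxI]; exact hx.1
      · rw [← hqv, hmono.le_iff_le hxI hq]; exact hx.2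

lemma cyl_Icc (w : List (Fin m)) : ∃ u v, u < v ∧ 0 ≤ u ∧ v ≤ 1 ∧ S.cyl w = Icc u v := by
  induction w with
  | nil => exact ⟨0, 1, by norm_num, le_rfl, le_rfl, rfl⟩
  | cons i w ih =>
    obtain ⟨u, v, huv, hu, hv, he⟩ := ih
    obtain ⟨p, q, hpq, hp, hq, -, -, he'⟩ := S.cyl_cons_aux i w huv hu hv he
    exact ⟨p, q, hpq, (S.hIsub i hp).1, (S.hIsub i hq).2, he'⟩

lemma cyl_eq (w : List (Fin m)) : S.cyl w = Icc (S.lo w) (S.hi w) := by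
  obtain ⟨u, v, huv, hu, hv, he⟩ := S.cyl_Icc w
  obtain ⟨h1, h2⟩ := S.lohi_of huv he
  rw [h1, h2, he]

lemma lo_lt_hi (w : List (Fin m)) : S.lo w < S.hi w := by
  obtain ⟨u, v, huv, hu, hv, he⟩ := S.cyl_Icc w
  obtain ⟨h1, h2⟩ := S.lohi_of huv he
  rw [h1, h2]; exact huv

lemma lo_nonneg (w : List (Fin m)) : 0 ≤ S.lo w := by
  obtain ⟨u, v, huv, hu, hv, he⟩ := S.cyl_Icc w
  obtain ⟨h1, h2⟩ := S.lohi_of huv he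
  rw [h1]; exact hu

lemma hi_le_one (w : List (Fin m)) : S.hi w ≤ 1 := by
  obtain ⟨u, v, huv, hu, hv, he⟩ := S.cyl_Icc w
  obtain ⟨h1, h2⟩ := S.lohi_of huv he
  rw [h2]; exact hv

lemma len_pos (w : List (Fin m)) : 0 < S.len w := sub_pos.2 (S.lo_lt_hi w)

lemma len_le_one (w : List (Fin m)) : S.len w ≤ 1 := by
  have := S.lo_nonneg w
  have := S.hi_le_one w
  unfold len; linarith

lemma cons_ends (i : Fin m) (w : List (Fin m)) :
    S.lo (i :: w) ∈ S.I i ∧ S.hi (i :: w) ∈ S.I i ∧ S.T (S.lo (i :: w)) = S.lo w ∧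
      S.T (S.hi (i :: w)) = S.hi w := by
  obtain ⟨p, q, hpq, hp, hq, h1, h2, he'⟩ := S.cyl_cons_aux i w (S.lo_lt_hi w) (S.lo_nonneg w)
    (S.hi_le_one w) (S.cyl_eq w)
  obtain ⟨e1, e2⟩ := S.lohi_of hpq he'
  rw [e1, e2]
  exact ⟨hp, hq, h1, h2⟩

lemma len_cons (i : Fin m) (w : List (Fin m)) :
    ∃ ξ ∈ S.cyl (i :: w), S.len w = S.T' ξ * S.len (i :: w) := by
  obtain ⟨hp, hq, h1, h2⟩ := S.cons_ends i w
  obtain ⟨ξ, hξ, h⟩ := S.mvt i hp hq (S.lo_lt_hi _)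
  refine ⟨ξ, ?_, ?_⟩
  · rw [S.cyl_eq]; exact ⟨hξ.1.le, hξ.2.le⟩
  · rw [h1, h2] at h; exact h

lemma len_cons_le (i : Fin m) (w : List (Fin m)) : S.len (i :: w) ≤ S.len w := by
  obtain ⟨hp, hq, h1, h2⟩ := S.cons_ends i w
  have := S.exp_le i hp hq (S.lo_lt_hi _).le
  rw [h1, h2] at this
  exact this

lemma cyl_cons_sub (i : Fin m) (w : List (Fin m)) : S.cyl (i :: w) ⊆ S.I i := fun _ hx => hx.1

lemma isCompact_I (i : Fin m) : IsCompact (S.I i) := by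
  obtain ⟨a, b, hab, hI⟩ := S.hI i
  rw [hI]; exact isCompact_Icc

lemma gap_one (i : Fin m) {δ : ℝ} (hδ : 0 < δ) : ∃ c > 0, ∀ x ∈ S.I i, ∀ y ∈ S.I i,
    x + δ ≤ y → (y - x) + c ≤ S.T y - S.T x := by
  have hK : IsCompact ((S.I i ×ˢ S.I i) ∩ {p : ℝ × ℝ | p.1 + δ ≤ p.2}) :=
    ((S.isCompact_I i).prod (S.isCompact_I i)).inter_right
      (isClosed_le (by fun_prop) (by fun_prop))
  rcases ((S.I i ×ˢ S.I i) ∩ {p : ℝ × ℝ | p.1 + δ ≤ p.2}).eq_empty_or_nonempty with he | hne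
  · refine ⟨1, one_pos, fun x hx y hy hxy => ?_⟩
    have : (x, y) ∈ ((S.I i ×ˢ S.I i) ∩ {p : ℝ × ℝ | p.1 + δ ≤ p.2}) := ⟨⟨hx, hy⟩, hxy⟩
    rw [he] at this
    exact absurd this (by simp)
  · have hc : ContinuousOn (fun p : ℝ × ℝ => S.T p.2 - S.T p.1 - (p.2 - p.1))
        ((S.I i ×ˢ S.I i) ∩ {p : ℝ × ℝ | p.1 + δ ≤ p.2}) := by
      refine ContinuousOn.sub (ContinuousOn.sub ?_ ?_) (by fun_prop)
      · exact (S.contT i).comp (by fun_prop) (fun p hp => hp.1.2)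
      · exact (S.contT i).comp (by fun_prop) (fun p hp => hp.1.1)
    obtain ⟨p, hp, hmin⟩ := hK.exists_isMinOn hne hc
    refine ⟨S.T p.2 - S.T p.1 - (p.2 - p.1), ?_, fun x hx y hy hxy => ?_⟩
    · have h2 : p.1 + δ ≤ p.2 := hp.2
      have := S.exp_lt i hp.1.1 hp.1.2 (by linarith)
      linarith
    · have := hmin (show (x, y) ∈ _ from ⟨⟨hx, hy⟩, hxy⟩)
      simp only [mem_ofPred_eq] at this
      linarith

lemma gap {δ : ℝ} (hδ : 0 < δ) : ∃ c > 0, ∀ i w, δ ≤ S.len (i :: w) →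
    S.len (i :: w) + c ≤ S.len w := by
  choose c hc h using fun i => S.gap_one i hδ
  have : Nonempty (Fin m) := ⟨⟨0, S.hm⟩⟩
  obtain ⟨i₀, hi₀⟩ := Finite.exists_min c
  refine ⟨c i₀, hc i₀, fun i w hw => ?_⟩
  obtain ⟨hp, hq, h1, h2⟩ := S.cons_ends i w
  have := h i _ hp _ hq (by unfold len at hw; linarith)
  rw [h1, h2] at this
  have h3 := hi₀ i
  unfold len
  linarith

lemma len_small {δ : ℝ} (hδ : 0 < δ) : ∃ N : ℕ, ∀ w : List (Fin m), N ≤ w.length →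
    S.len w < δ := by
  obtain ⟨c, hc, h⟩ := S.gap hδ
  have key : ∀ w : List (Fin m), δ ≤ S.len w → S.len w + c * w.length ≤ 1 := by
    intro w
    induction w with
    | nil => intro _; simpa using S.len_le_one []
    | cons i w ih =>
      intro hw
      have h1 := h i w hw
      have h2 := ih (hw.trans (S.len_cons_le i w))
      simp only [List.length_cons, Nat.cast_add, Nat.cast_one]
      linarith
  obtain ⟨N, hN⟩ := exists_nat_gt (1 / c)
  refine ⟨N, fun w hw => ?_⟩
  by_contra hcon
  push Not at hcon
  have h1 := key w hcon
  rw [div_lt_iff₀ hc] at hN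
  have : (N : ℝ) ≤ w.length := by exact_mod_cast hw
  nlinarith

lemma T'_bdd : ∃ B : ℝ, 0 ≤ B ∧ ∀ i, ∀ x ∈ S.I i, Real.log (S.T' x) ≤ B := by
  have : ∀ i, ∃ B : ℝ, ∀ x ∈ S.I i, Real.log (S.T' x) ≤ B := by
    intro i
    obtain ⟨B, hB⟩ := (S.isCompact_I i).bddAbove_image (f := fun x => Real.log (S.T' x))
      ((S.hT'cont i).log (fun x hx => by have := S.one_le_T' i hx; positivity))
    exact ⟨B, fun x hx => hB (mem_image_of_mem _ hx)⟩
  choose B hB using this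
  have : Nonempty (Fin m) := ⟨⟨0, S.hm⟩⟩
  obtain ⟨i₀, hi₀⟩ := Finite.exists_max B
  exact ⟨max 0 (B i₀), le_max_left _ _, fun i x hx => ((hB i x hx).trans (hi₀ i)).trans
    (le_max_right _ _)⟩

lemma osc {ε : ℝ} (hε : 0 < ε) : ∃ N : ℕ, ∀ w : List (Fin m), N ≤ w.length →
    ∀ x ∈ S.cyl w, ∀ y ∈ S.cyl w, |Real.log (S.T' x) - Real.log (S.T' y)| ≤ ε := by
  have : ∀ i, ∃ δ > 0, ∀ x ∈ S.I i, ∀ y ∈ S.I i, |x - y| < δ →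
      |Real.log (S.T' x) - Real.log (S.T' y)| ≤ ε := by
    intro i
    have := (S.isCompact_I i).uniformContinuousOn_of_continuous (f := fun x => Real.log (S.T' x))
      ((S.hT'cont i).log (fun x hx => by have := S.one_le_T' i hx; positivity))
    rw [Metric.uniformContinuousOn_iff] at this
    obtain ⟨δ, hδ, h⟩ := this ε hε
    exact ⟨δ, hδ, fun x hx y hy hxy => (h x hx y hy hxy).le⟩
  choose δ hδ h using this
  have : Nonempty (Fin m) := ⟨⟨0, S.hm⟩⟩
  obtain ⟨i₀, hi₀⟩ := Finite.exists_min δ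
  obtain ⟨N, hN⟩ := S.len_small (hδ i₀)
  refine ⟨N + 1, fun w hw x hx y hy => ?_⟩
  cases w with
  | nil => simp at hw
  | cons i w =>
    have hl := hN (i :: w) (by omega)
    refine h i x (S.cyl_cons_sub i w hx) y (S.cyl_cons_sub i w hy) ?_
    rw [S.cyl_eq] at hx hy
    refine lt_of_lt_of_le ?_ (hi₀ i)
    refine lt_of_le_of_lt ?_ hl
    rw [abs_le]
    unfold len
    constructor <;> linarith [hx.1, hx.2, hy.1, hy.2]

end PCSystem

section
variable {m : ℕ}

lemma word_zero (ω : SymbSp m) : word ω 0 = [] := by simp [word]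

lemma word_succ (ω : SymbSp m) (n : ℕ) : word ω (n + 1) = ω 0 :: word (shift ω) n := by
  simp [word, List.ofFn_succ, shift]

lemma word_length (ω : SymbSp m) (n : ℕ) : (word ω n).length = n := by simp [word]

lemma shift_iter (ω : SymbSp m) (n i : ℕ) : (shift^[n] ω) i = ω (i + n) := by
  induction n generalizing ω with
  | zero => rfl
  | succ n ih => rw [Function.iterate_succ_apply, ih]; simp [shift, add_assoc]

lemma word_congr {ω ω' : SymbSp m} {n : ℕ} (h : ∀ i < n, ω i = ω' i) : word ω n = word ω' n := by
  unfold word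
  congr 1
  funext j
  exact h j j.2

lemma word_inj {ω ω' : SymbSp m} {n : ℕ} (h : word ω n = word ω' n) : ∀ i < n, ω i = ω' i := by
  intro i hi
  have := List.ofFn_injective h
  exact congrFun this ⟨i, hi⟩

lemma continuous_shift : Continuous (shift : SymbSp m → SymbSp m) :=
  continuous_pi fun n => continuous_apply (n + 1)

lemma measurable_shift : Measurable (shift : SymbSp m → SymbSp m) :=
  measurable_pi_lambda _ fun n => measurable_pi_apply (n + 1)

end

namespace PCSystem

variable {m : ℕ} (S : PCSystem m)

lemma cyl_word_anti (ω : SymbSp m) (n : ℕ) : S.cyl (word ω (n + 1)) ⊆ S.cyl (word ω n) := by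
  induction n generalizing ω with
  | zero =>
    rw [word_zero, S.cyl_eq (word ω _)]
    exact Icc_subset_Icc (S.lo_nonneg _) (S.hi_le_one _)
  | succ n ih =>
    rw [word_succ, word_succ ω n]
    exact fun x hx => ⟨hx.1, ih (shift ω) hx.2⟩

lemma code_mem_iInter (ω : SymbSp m) : S.code ω ∈ ⋂ n : ℕ, S.cyl (word ω n) := by
  have hc : ∀ n, IsCompact (S.cyl (word ω n)) := fun n => by
    rw [S.cyl_eq]; exact isCompact_Icc
  have hne : (⋂ n : ℕ, S.cyl (word ω n)).Nonempty :=
    IsCompact.nonempty_iInter_of_sequence_nonempty_isCompact_isClosed _ (S.cyl_word_anti ω)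
      (fun n => by rw [S.cyl_eq]; exact nonempty_Icc.2 (S.lo_lt_hi _).le) (hc 0)
      (fun n => (hc n).isClosed)
  exact ((hc 0).of_isClosed_subset (isClosed_iInter fun n => (hc n).isClosed)
    (iInter_subset _ 0)).sSup_mem hne

lemma code_mem (ω : SymbSp m) (n : ℕ) : S.code ω ∈ S.cyl (word ω n) :=
  mem_iInter.1 (S.code_mem_iInter ω) n

lemma abs_sub_le_len {w : List (Fin m)} {x y : ℝ} (hx : x ∈ S.cyl w) (hy : y ∈ S.cyl w) :
    |x - y| ≤ S.len w := by
  rw [S.cyl_eq] at hx hy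
  rw [abs_le]
  unfold len
  constructor <;> linarith [hx.1, hx.2, hy.1, hy.2]

lemma code_unique (ω : SymbSp m) {x : ℝ} (hx : ∀ n, x ∈ S.cyl (word ω n)) : x = S.code ω := by
  by_contra hne
  have hpos : 0 < |x - S.code ω| := abs_pos.2 (sub_ne_zero.2 hne)
  obtain ⟨N, hN⟩ := S.len_small hpos
  have h1 := hN (word ω N) (by rw [word_length])
  have h2 := S.abs_sub_le_len (hx N) (S.code_mem ω N)
  linarith

lemma T_code (ω : SymbSp m) : S.T (S.code ω) = S.code (shift ω) := by
  refine S.code_unique _ fun n => ?_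
  have := S.code_mem ω (n + 1)
  rw [word_succ] at this
  exact this.2

lemma code_mem_I (ω : SymbSp m) : S.code ω ∈ S.I (ω 0) := by
  have := S.code_mem ω 1
  rw [word_succ] at this
  exact this.1

lemma g_nonneg (ω : SymbSp m) : 0 ≤ S.g ω := Real.log_nonneg (S.one_le_T' _ (S.code_mem_I ω))

end PCSystem

section
variable {m : ℕ}

lemma cyl_nhds (ω : SymbSp m) {U : Set (SymbSp m)} (hU : U ∈ 𝓝 ω) :
    ∃ n, PiNat.cylinder ω n ⊆ U := by
  obtain ⟨V, hV, hωV, hVU⟩ := (PiNat.isTopologicalBasis_cylinders (fun _ : ℕ => Fin m)).mem_nhds_iff.1 hU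
  obtain ⟨x, n, rfl⟩ := hV
  refine ⟨n, ?_⟩
  rw [PiNat.mem_cylinder_iff_eq.1 hωV]
  exact hVU

lemma unif_cont {E : Type*} [PseudoMetricSpace E] (φ : SymbSp m → E) (hφ : Continuous φ) {ε : ℝ}
    (hε : 0 < ε) :
    ∃ N : ℕ, ∀ ω ω' : SymbSp m, (∀ i < N, ω i = ω' i) → dist (φ ω) (φ ω') ≤ ε := by
  have h1 : ∀ ω : SymbSp m, ∃ n, PiNat.cylinder ω n ⊆ φ ⁻¹' (Metric.ball (φ ω) (ε / 2)) :=
    fun ω => cyl_nhds ω (hφ.continuousAt.preimage_mem_nhds (Metric.ball_mem_nhds _ (by linarith)))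
  choose n hn using h1
  obtain ⟨t, ht⟩ := isCompact_univ.elim_finite_subcover
    (fun ω : SymbSp m => PiNat.cylinder ω (n ω)) (fun ω => PiNat.isOpen_cylinder _ _ _)
    (fun ω _ => mem_iUnion.2 ⟨ω, PiNat.self_mem_cylinder _ _⟩)
  refine ⟨t.sup n, fun ω ω' h => ?_⟩
  obtain ⟨η, hη, hωη⟩ := mem_iUnion₂.1 (ht (mem_univ ω))
  have h2 : ω' ∈ PiNat.cylinder η (n η) := fun i hi => by
    rw [← h i (lt_of_lt_of_le hi (Finset.le_sup hη))]; exact hωη i hi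
  have h3 := hn η hωη
  have h4 := hn η h2
  simp only [mem_preimage, Metric.mem_ball] at h3 h4
  have := dist_triangle_right (φ ω) (φ ω') (φ η)
  linarith

lemma bdd_of_cont (φ : SymbSp m → ℝ) (hφ : Continuous φ) :
    ∃ B : ℝ, 0 ≤ B ∧ ∀ ω, |φ ω| ≤ B := by
  obtain ⟨B, hB⟩ := (isCompact_univ.image (continuous_abs.comp hφ)).bddAbove
  refine ⟨max B 0, le_max_right _ _, fun ω => le_trans (hB ?_) (le_max_left _ _)⟩
  exact ⟨ω, mem_univ _, rfl⟩

lemma sum_var (φ : SymbSp m → ℝ) (hφ : Continuous φ) {ε : ℝ} (hε : 0 < ε) :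
    ∃ N : ℕ, ∀ n ≥ N, ∀ ω ω' : SymbSp m, (∀ i < n, ω i = ω' i) →
      |birkhoffSum shift φ n ω - birkhoffSum shift φ n ω'| ≤ ε * n := by
  obtain ⟨N, hN⟩ := unif_cont φ hφ (half_pos hε)
  obtain ⟨B, hB0, hB⟩ := bdd_of_cont φ hφ
  have key : ∀ n : ℕ, ∀ ω ω' : SymbSp m, (∀ i < n, ω i = ω' i) →
      |birkhoffSum shift φ n ω - birkhoffSum shift φ n ω'| ≤ ε / 2 * n + 2 * B * min (n:ℝ) N := by
    intro n
    induction n with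
    | zero => intro ω ω' _; simp
    | succ n ih =>
      intro ω ω' h
      rw [birkhoffSum_succ', birkhoffSum_succ']
      have h1 := ih (shift ω) (shift ω') (fun i hi => h (i + 1) (by omega))
      have h2 : |φ ω - φ ω'| ≤ ε / 2 ∧ N ≤ n + 1 ∨ |φ ω - φ ω'| ≤ 2 * B ∧ n + 1 < N := by
        rcases le_or_gt N (n + 1) with hle | hlt
        · exact Or.inl ⟨hN ω ω' (fun i hi => h i (by omega)), hle⟩
        · refine Or.inr ⟨?_, hlt⟩
          have := abs_sub (φ ω) (φ ω')
          linarith [hB ω, hB ω']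
      have h3 : |φ ω + birkhoffSum shift φ n (shift ω) - (φ ω' + birkhoffSum shift φ n (shift ω'))|
          ≤ |φ ω - φ ω'| + |birkhoffSum shift φ n (shift ω) - birkhoffSum shift φ n (shift ω')| := by
        rw [show φ ω + birkhoffSum shift φ n (shift ω) - (φ ω' + birkhoffSum shift φ n (shift ω'))
          = (φ ω - φ ω') + (birkhoffSum shift φ n (shift ω) - birkhoffSum shift φ n (shift ω')) by ring]
        exact abs_add_le _ _
      rcases h2 with ⟨h2, hle⟩ | ⟨h2, hlt⟩
      · have h4 : (min n N : ℝ) ≤ min ((n + 1 : ℕ) : ℝ) N := by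
          push_cast
          gcongr
          linarith
        have h5 := mul_le_mul_of_nonneg_left h4 (show 0 ≤ 2 * B by linarith)
        push_cast at h5 ⊢
        linarith
      · have e1 : (min n N : ℝ) = n := min_eq_left (by exact_mod_cast (by omega : n ≤ N))
        have e2 : (min ((n + 1 : ℕ) : ℝ) N) = n + 1 := by
          rw [min_eq_left (by exact_mod_cast hlt.le)]; push_cast; ring
        rw [e1] at h1
        rw [e2]
        push_cast
        linarith
  obtain ⟨M, hM⟩ := exists_nat_gt (2 * B * N / (ε / 2))
  refine ⟨M, fun n hn ω ω' h => (key n ω ω' h).trans ?_⟩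
  rw [div_lt_iff₀ (half_pos hε)] at hM
  have h1 : (M : ℝ) ≤ n := by exact_mod_cast hn
  have h2 : (min n N : ℝ) ≤ N := min_le_right _ _
  have h3 := mul_le_mul_of_nonneg_left h2 (show 0 ≤ 2 * B by linarith)
  nlinarith
end

namespace PCSystem

variable {m : ℕ} (S : PCSystem m)

lemma continuous_code : Continuous S.code := by
  rw [continuous_iff_continuousAt]
  intro ω
  rw [Metric.continuousAt_iff']
  intro ε hε
  obtain ⟨N, hN⟩ := S.len_small hε
  filter_upwards [(PiNat.isOpen_cylinder _ ω N).mem_nhds (PiNat.self_mem_cylinder ω N)] with ω' h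
  have h1 := S.code_mem ω' N
  rw [word_congr (fun i hi => h i hi)] at h1
  exact lt_of_le_of_lt (S.abs_sub_le_len h1 (S.code_mem ω N)) (hN _ (by rw [word_length]))

lemma continuous_g : Continuous S.g := by
  rw [continuous_iff_continuousAt]
  intro ω
  rw [Metric.continuousAt_iff']
  intro ε hε
  obtain ⟨N, hN⟩ := S.osc (half_pos hε)
  filter_upwards [(PiNat.isOpen_cylinder _ ω N).mem_nhds (PiNat.self_mem_cylinder ω N)] with ω' h
  have h1 := S.code_mem ω' N
  rw [word_congr (fun i hi => h i hi)] at h1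
  exact lt_of_le_of_lt (hN _ (by rw [word_length]) _ h1 _ (S.code_mem ω N)) (by linarith)

/-- Length of the basic intervals versus Birkhoff sums. -/
lemma len_birkhoff {ε : ℝ} (hε : 0 < ε) : ∃ N : ℕ, ∀ n ≥ N, ∀ ω : SymbSp m,
    |-Real.log (S.len (word ω n)) - birkhoffSum shift S.g n ω| ≤ ε * n := by
  obtain ⟨N, hN⟩ := S.osc (half_pos hε)
  obtain ⟨B, hB0, hB⟩ := S.T'_bdd
  have key : ∀ n : ℕ, ∀ ω : SymbSp m,
      |-Real.log (S.len (word ω n)) - birkhoffSum shift S.g n ω| ≤ ε / 2 * n + B * min (n:ℝ) N := by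
    intro n
    induction n with
    | zero =>
      intro ω
      have : S.len (word ω 0) = 1 := by
        rw [word_zero]
        unfold len
        obtain ⟨h1, h2⟩ := S.lohi_of (w := []) zero_lt_one rfl
        rw [h1, h2]; norm_num
      simp [this]
    | succ n ih =>
      intro ω
      rw [birkhoffSum_succ']
      have h1 := ih (shift ω)
      obtain ⟨ξ, hξ, hlen⟩ := S.len_cons (ω 0) (word (shift ω) n)
      rw [← word_succ] at hξ hlen
      have hξI : ξ ∈ S.I (ω 0) := by rw [word_succ] at hξ; exact hξ.1
      have hT1 := S.one_le_T' _ hξI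
      have hl : Real.log (S.len (word (shift ω) n))
          = Real.log (S.T' ξ) + Real.log (S.len (word ω (n + 1))) := by
        rw [hlen, Real.log_mul (by positivity) (S.len_pos _).ne']
      have h2 : |Real.log (S.T' ξ) - S.g ω| ≤ ε / 2 ∧ N ≤ n + 1 ∨
          |Real.log (S.T' ξ) - S.g ω| ≤ B ∧ n + 1 < N := by
        rcases le_or_gt N (n + 1) with hle | hlt
        · exact Or.inl ⟨hN _ (by rw [word_length]; exact hle) _ hξ _ (S.code_mem ω _), hle⟩
        · refine Or.inr ⟨?_, hlt⟩
          have a1 := Real.log_nonneg hT1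
          have a2 := hB _ _ hξI
          have a3 := S.g_nonneg ω
          have a4 : S.g ω ≤ B := hB _ _ (S.code_mem_I ω)
          rw [abs_le]; constructor <;> linarith
      have h3 : |-Real.log (S.len (word ω (n + 1))) - (S.g ω + birkhoffSum shift S.g n (shift ω))|
          ≤ |Real.log (S.T' ξ) - S.g ω| + |-Real.log (S.len (word (shift ω) n)) - birkhoffSum shift S.g n (shift ω)| := by
        refine le_trans (le_of_eq ?_) (abs_add_le _ _)
        rw [hl]; congr 1; ring
      rcases h2 with ⟨h2, hle⟩ | ⟨h2, hlt⟩
      · have h4 : (min n N : ℝ) ≤ min ((n + 1 : ℕ) : ℝ) N := by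
          push_cast
          gcongr
          linarith
        have h5 := mul_le_mul_of_nonneg_left h4 hB0
        push_cast at h5 ⊢
        linarith
      · have e1 : (min n N : ℝ) = n := min_eq_left (by exact_mod_cast (by omega : n ≤ N))
        have e2 : (min ((n + 1 : ℕ) : ℝ) N) = n + 1 := by
          rw [min_eq_left (by exact_mod_cast hlt.le)]; push_cast; ring
        rw [e1] at h1
        rw [e2]
        push_cast
        linarith
  obtain ⟨M, hM⟩ := exists_nat_gt (B * N / (ε / 2))
  refine ⟨M, fun n hn ω => (key n ω).trans ?_⟩
  rw [div_lt_iff₀ (half_pos hε)] at hM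
  have h1 : (M : ℝ) ≤ n := by exact_mod_cast hn
  have h2 : (min n N : ℝ) ≤ N := min_le_right _ _
  have h3 := mul_le_mul_of_nonneg_left h2 hB0
  nlinarith

/-- Basic intervals of distinct words of the same length are disjoint. -/
lemma cyl_disjoint (n : ℕ) (ω ω' : SymbSp m) (h : word ω n ≠ word ω' n) :
    Disjoint (S.cyl (word ω n)) (S.cyl (word ω' n)) := by
  induction n generalizing ω ω' with
  | zero => simp [word_zero] at h
  | succ n ih =>
    rw [word_succ, word_succ] at h ⊢
    rw [Set.disjoint_left]
    intro x hx hx'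
    by_cases h0 : ω 0 = ω' 0
    · have h1 : word (shift ω) n ≠ word (shift ω') n := by
        intro h1; apply h; rw [h0, h1]
      exact Set.disjoint_left.1 (ih _ _ h1) hx.2 hx'.2
    · exact Set.disjoint_left.1 (S.I_disjoint h0) hx.1 hx'.1

end PCSystem


/-! ### Gibbs inequality -/

lemma gibbs {ι : Type*} [Fintype ι] (p q : ι → ℝ) (hp : ∀ i, 0 ≤ p i) (hp1 : ∑ i, p i = 1)
    (hq : ∀ i, 0 < q i) (hq1 : ∑ i, q i ≤ 1) :
    ∑ i, Real.negMulLog (p i) ≤ ∑ i, p i * (-Real.log (q i)) := by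
  have h : ∀ i, Real.negMulLog (p i) ≤ p i * (-Real.log (q i)) + (q i - p i) := by
    intro i
    rcases (hp i).eq_or_lt with h0 | h0
    · rw [← h0]; simp [(hq i).le]
    · have h1 := Real.log_le_sub_one_of_pos (div_pos (hq i) h0)
      rw [Real.log_div (hq i).ne' h0.ne'] at h1
      have h2 := mul_le_mul_of_nonneg_left h1 h0.le
      rw [mul_sub, mul_sub, mul_div_cancel₀ _ h0.ne'] at h2
      rw [Real.negMulLog]
      linarith
  calc ∑ i, Real.negMulLog (p i) ≤ ∑ i, (p i * (-Real.log (q i)) + (q i - p i)) :=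
        Finset.sum_le_sum fun i _ => h i
    _ = ∑ i, p i * (-Real.log (q i)) + (∑ i, q i - ∑ i, p i) := by
        rw [Finset.sum_add_distrib, Finset.sum_sub_distrib]
    _ ≤ _ := by linarith

lemma gibbs_inj {ι κ : Type*} [Fintype ι] [Fintype κ] (p : ι → ℝ) (hp : ∀ i, 0 ≤ p i)
    (hp1 : ∑ i, p i = 1) (Y : ι → κ) (hY : Function.Injective Y) (Q : κ → ℝ) (hQ : ∀ k, 0 < Q k)
    (hQ1 : ∑ k, Q k ≤ 1) :
    ∑ i, Real.negMulLog (p i) ≤ ∑ i, p i * (-Real.log (Q (Y i))) := by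
  classical
  refine gibbs p (fun i => Q (Y i)) hp hp1 (fun i => hQ _) (le_trans ?_ hQ1)
  rw [← Finset.sum_image (f := Q) (s := Finset.univ) (g := Y) (fun a _ b _ h => hY h)]
  exact Finset.sum_le_sum_of_subset_of_nonneg (Finset.subset_univ _) (fun k _ _ => (hQ k).le)

lemma fin_int {Ω : Type*} [MeasurableSpace Ω] (μ : Measure Ω) [IsProbabilityMeasure μ]
    {ι : Type*} [Fintype ι] (X : Ω → ι) (hX : ∀ a, MeasurableSet (X ⁻¹' {a})) (G : ι → ℝ) :
    Integrable (fun ω => G (X ω)) μ ∧ ∫ ω, G (X ω) ∂μ = ∑ a, μ.real (X ⁻¹' {a}) * G a := by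
  let _ : MeasurableSpace ι := ⊤
  have : DiscreteMeasurableSpace ι := ⟨fun _ => trivial⟩
  have hXm : Measurable X := measurable_to_countable' hX
  have : IsProbabilityMeasure (μ.map X) := Measure.isProbabilityMeasure_map hXm.aemeasurable
  have h1 : Integrable G (μ.map X) := Integrable.of_finite
  refine ⟨h1.comp_measurable hXm, ?_⟩
  rw [← integral_map (f := G) hXm.aemeasurable h1.aestronglyMeasurable, integral_fintype h1]
  refine Finset.sum_congr rfl fun a _ => ?_
  rw [map_measureReal_apply hXm (measurableSet_singleton a), smul_eq_mul]

lemma sum_fin_int {Ω : Type*} [MeasurableSpace Ω] (μ : Measure Ω) [IsProbabilityMeasure μ]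
    {ι : Type*} [Fintype ι] (X : Ω → ι) (hX : ∀ a, MeasurableSet (X ⁻¹' {a})) :
    ∑ a, μ.real (X ⁻¹' {a}) = 1 := by
  have := (fin_int μ X hX (fun _ => 1)).2
  simpa using this.symm

lemma gibbs_joint {Ω : Type*} [MeasurableSpace Ω] (μ : Measure Ω) [IsProbabilityMeasure μ]
    {ι κ : Type*} [Fintype ι] [Fintype κ] (X : Ω → ι) (hX : ∀ a, MeasurableSet (X ⁻¹' {a}))
    (Y : Ω → κ) (hY : ∀ b, MeasurableSet (Y ⁻¹' {b})) (Q : ι → κ → ℝ) (hQ : ∀ a b, 0 < Q a b)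
    (hQ1 : ∑ b, ∑ a, Q a b ≤ 1) :
    ∑ a, Real.negMulLog (μ.real (X ⁻¹' {a})) ≤ ∫ ω, -Real.log (Q (X ω) (Y ω)) ∂μ := by
  have hne : Nonempty Ω := by
    by_contra h
    rw [not_nonempty_iff] at h
    have := measure_univ (μ := μ)
    rw [univ_eq_empty_iff.2 h] at this
    simp at this
  have hκ : Nonempty κ := hne.map Y
  have hq : ∀ a, 0 < ∑ b, Q a b := fun a =>
    Finset.sum_pos (fun b _ => hQ a b) Finset.univ_nonempty
  have h1 := gibbs (fun a => μ.real (X ⁻¹' {a})) (fun a => ∑ b, Q a b)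
    (fun a => measureReal_nonneg) (sum_fin_int μ X hX) hq (by rw [Finset.sum_comm]; exact hQ1)
  refine h1.trans ?_
  rw [← (fin_int μ X hX (fun a => -Real.log (∑ b, Q a b))).2]
  have hXY : ∀ c : ι × κ, MeasurableSet ((fun ω => (X ω, Y ω)) ⁻¹' {c}) := by
    rintro ⟨a, b⟩
    have : ((fun ω => (X ω, Y ω)) ⁻¹' {(a, b)}) = X ⁻¹' {a} ∩ Y ⁻¹' {b} := by
      ext ω; simp
    rw [this]
    exact (hX a).inter (hY b)
  refine integral_mono (fin_int μ X hX (fun a => -Real.log (∑ b, Q a b))).1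
    (fin_int μ (fun ω => (X ω, Y ω)) hXY (fun c => -Real.log (Q c.1 c.2))).1 ?_
  intro ω
  simp only [neg_le_neg_iff]
  refine Real.log_le_log (hQ _ _) ?_
  exact Finset.single_le_sum (f := fun b => Q (X ω) b) (fun b _ => (hQ _ b).le) (Finset.mem_univ _)

section
variable {m : ℕ}

def pre (n : ℕ) (ω : SymbSp m) : Fin n → Fin m := fun j => ω j

lemma measurable_pre (n : ℕ) : Measurable (pre n : SymbSp m → _) :=
  measurable_pi_lambda _ fun j => measurable_pi_apply _

lemma meas_pre (n : ℕ) (w : Fin n → Fin m) : MeasurableSet (pre n ⁻¹' {w}) :=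
  measurable_pre n (measurableSet_singleton w)

lemma continuous_pre (n : ℕ) : Continuous (pre n : SymbSp m → _) :=
  continuous_pi fun j => continuous_apply _

/-- entropy of the `n`-cylinder distribution -/
def Hc (μ : Measure (SymbSp m)) (n : ℕ) : ℝ :=
  ∑ w : Fin n → Fin m, Real.negMulLog (μ.real (pre n ⁻¹' {w}))

lemma Hc_nonneg (μ : Measure (SymbSp m)) [IsProbabilityMeasure μ] (n : ℕ) : 0 ≤ Hc μ n :=
  Finset.sum_nonneg fun _ _ => Real.negMulLog_nonneg measureReal_nonneg measureReal_le_one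

/-- smoothed cylinder distribution -/
def spi (μ : Measure (SymbSp m)) (n : ℕ) (δ : ℝ) (w : Fin n → Fin m) : ℝ :=
  (1 - δ) * μ.real (pre n ⁻¹' {w}) + δ / (m : ℝ) ^ n

lemma spi_pos (hm : 0 < m) (μ : Measure (SymbSp m)) (n : ℕ) {δ : ℝ} (h0 : 0 < δ) (h1 : δ < 1)
    (w : Fin n → Fin m) : 0 < spi μ n δ w := by
  have : (0:ℝ) < m := by exact_mod_cast hm
  have h2 : 0 < δ / (m : ℝ) ^ n := by positivity
  have h3 : 0 ≤ (1 - δ) * μ.real (pre n ⁻¹' {w}) := mul_nonneg (by linarith) measureReal_nonneg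
  unfold spi
  linarith

lemma spi_sum (hm : 0 < m) (μ : Measure (SymbSp m)) [IsProbabilityMeasure μ] (n : ℕ) (δ : ℝ) :
    ∑ w, spi μ n δ w = 1 := by
  have : (m:ℝ) ≠ 0 := by exact_mod_cast hm.ne'
  unfold spi
  rw [Finset.sum_add_distrib, ← Finset.mul_sum, sum_fin_int μ (pre n) (meas_pre n)]
  simp
  field_simp
  ring

lemma spi_le_one (hm : 0 < m) (μ : Measure (SymbSp m)) [IsProbabilityMeasure μ] (n : ℕ) {δ : ℝ}
    (h0 : 0 < δ) (h1 : δ < 1) (w : Fin n → Fin m) : spi μ n δ w ≤ 1 := by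
  rw [← spi_sum hm μ n δ]
  exact Finset.single_le_sum (f := spi μ n δ) (fun b _ => (spi_pos hm μ n h0 h1 b).le)
    (Finset.mem_univ _)

lemma spi_int (hm : 0 < m) (μ : Measure (SymbSp m)) [IsProbabilityMeasure μ] (n : ℕ) {δ : ℝ}
    (h0 : 0 < δ) (h1 : δ < 1) :
    ∫ ω, -Real.log (spi μ n δ (pre n ω)) ∂μ ≤ Hc μ n - Real.log (1 - δ) := by
  rw [(fin_int μ (pre n) (meas_pre n) (fun w => -Real.log (spi μ n δ w))).2]
  have h : ∀ w : Fin n → Fin m, μ.real (pre n ⁻¹' {w}) * -Real.log (spi μ n δ w) ≤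
      Real.negMulLog (μ.real (pre n ⁻¹' {w})) + μ.real (pre n ⁻¹' {w}) * (- Real.log (1 - δ)) := by
    intro w
    rcases (measureReal_nonneg (μ := μ) (s := pre n ⁻¹' {w})).eq_or_lt with hz | hz
    · rw [← hz]; simp
    · have h2 : (1 - δ) * μ.real (pre n ⁻¹' {w}) ≤ spi μ n δ w := by
        unfold spi
        have : 0 ≤ δ / (m : ℝ) ^ n := by positivity
        linarith
      have h3 := Real.log_le_log (mul_pos (by linarith) hz) h2
      rw [Real.log_mul (by linarith) hz.ne'] at h3
      rw [Real.negMulLog]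
      nlinarith
  refine (Finset.sum_le_sum fun w _ => h w).trans (le_of_eq ?_)
  rw [Finset.sum_add_distrib, ← Finset.sum_mul, sum_fin_int μ (pre n) (meas_pre n), Hc]
  ring

lemma int_shift {μ : Measure (SymbSp m)} (hμ : μ.map shift = μ) (F : SymbSp m → ℝ)
    (hF : AEStronglyMeasurable F μ) (j : ℕ) : ∫ ω, F (shift^[j] ω) ∂μ = ∫ ω, F ω ∂μ := by
  have hp : MeasurePreserving (shift : SymbSp m → SymbSp m) μ μ := ⟨measurable_shift, hμ⟩
  have hj := hp.iterate j
  have := integral_map (μ := μ) (φ := shift^[j]) (f := F) hj.measurable.aemeasurable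
    (by rw [hj.map_eq]; exact hF)
  rw [hj.map_eq] at this
  exact this.symm

/-- approximation of a finite measurable function by a cylinder function -/
lemma approx_cyl (μ : Measure (SymbSp m)) [IsProbabilityMeasure μ] {ι : Type*} [Fintype ι]
    [Nonempty ι] (X : SymbSp m → ι) (hX : ∀ a, MeasurableSet (X ⁻¹' {a})) {η : ℝ} (hη : 0 < η) :
    ∃ (k : ℕ) (φ : (Fin k → Fin m) → ι), μ.real {ω | X ω ≠ φ (pre k ω)} ≤ η := by
  classical
  have hc : (0:ℝ) < Fintype.card ι := by exact_mod_cast Fintype.card_pos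
  have h1 : ∀ a, ∃ K ⊆ X ⁻¹' {a}, IsCompact K ∧
      μ (X ⁻¹' {a} \ K) < ENNReal.ofReal (η / Fintype.card ι) := fun a =>
    (hX a).exists_isCompact_sdiff_lt (measure_ne_top _ _)
      (ENNReal.ofReal_pos.2 (by positivity)).ne'
  choose K hKX hKc hKμ using h1
  have hUc : IsCompact (⋃ a, K a) := isCompact_iUnion hKc
  have h2 : ∀ ω : SymbSp m, ∃ n, ω ∈ (⋃ a, K a) → ∀ ω' ∈ PiNat.cylinder ω n,
      ω' ∈ (⋃ a, K a) → X ω' = X ω := by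
    intro ω
    by_cases hω : ω ∈ ⋃ a, K a
    · have ho : (⋃ b ∈ {b | b ≠ X ω}, K b)ᶜ ∈ 𝓝 ω := by
        refine IsOpen.mem_nhds ?_ ?_
        · rw [isOpen_compl_iff]
          exact Set.Finite.isClosed_biUnion (Set.toFinite _) (fun b _ => (hKc b).isClosed)
        · simp only [mem_compl_iff, mem_iUnion, not_exists]
          intro b hb hωb
          exact hb (hKX b hωb).symm
      obtain ⟨n, hn⟩ := cyl_nhds ω ho
      refine ⟨n, fun _ ω' hω' hK => ?_⟩
      obtain ⟨b, hb⟩ := mem_iUnion.1 hK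
      have e : X ω' = b := hKX b hb
      by_contra hne
      apply hn hω'
      exact mem_iUnion₂.2 ⟨b, by rw [← e]; exact hne, hb⟩
    · exact ⟨0, fun h => absurd h hω⟩
  choose n hn using h2
  obtain ⟨t, htK⟩ := hUc.elim_nhds_subcover' (fun ω _ => PiNat.cylinder ω (n ω))
    (fun ω _ => (PiNat.isOpen_cylinder _ _ _).mem_nhds (PiNat.self_mem_cylinder _ _))
  let k := t.sup (fun x => n x)
  have hk : ∀ ω ∈ ⋃ a, K a, ∀ ω' ∈ ⋃ a, K a, pre k ω = pre k ω' → X ω = X ω' := by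
    intro ω hω ω' hω' hp
    obtain ⟨x, hx, hωx⟩ := mem_iUnion₂.1 (htK hω)
    have h3 : ω' ∈ PiNat.cylinder (x : SymbSp m) (n x) := by
      intro i hi
      have hik : i < k := lt_of_lt_of_le hi (Finset.le_sup (f := fun x : ((⋃ a, K a : Set (SymbSp m))) => n x) hx)
      have h4 : ω i = ω' i := congrFun hp ⟨i, hik⟩
      rw [← h4]; exact hωx i hi
    rw [hn x x.2 ω hωx hω, hn x x.2 ω' h3 hω']
  let φ : (Fin k → Fin m) → ι := fun v =>
    if h : ∃ ω ∈ ⋃ a, K a, pre k ω = v then X h.choose else Classical.arbitrary ι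
  have hφ : ∀ ω ∈ ⋃ a, K a, φ (pre k ω) = X ω := by
    intro ω hω
    have h : ∃ ω' ∈ ⋃ a, K a, pre k ω' = pre k ω := ⟨ω, hω, rfl⟩
    simp only [φ, dif_pos h]
    exact hk _ h.choose_spec.1 _ hω h.choose_spec.2
  refine ⟨k, φ, ?_⟩
  have hsub : {ω | X ω ≠ φ (pre k ω)} ⊆ ⋃ a, (X ⁻¹' {a} \ K a) := by
    intro ω hω
    refine mem_iUnion.2 ⟨X ω, rfl, fun hK => hω ?_⟩
    exact (hφ ω (mem_iUnion.2 ⟨_, hK⟩)).symm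
  calc μ.real {ω | X ω ≠ φ (pre k ω)} ≤ μ.real (⋃ a, (X ⁻¹' {a} \ K a)) :=
        measureReal_mono hsub
    _ ≤ ∑ a, μ.real (X ⁻¹' {a} \ K a) := measureReal_iUnion_fintype_le _
    _ ≤ ∑ _a : ι, η / Fintype.card ι := by
        refine Finset.sum_le_sum fun a _ => ?_
        exact ENNReal.toReal_le_of_le_ofReal (by positivity) (hKμ a).le
    _ = η := by
        simp
        field_simp

lemma sum_prod_le_one {ι V : Type*} [Fintype ι] [DecidableEq ι] [Fintype V] (F : ι → V → ℝ)
    (h0 : ∀ i v, 0 ≤ F i v) (h1 : ∀ i, ∑ v, F i v ≤ 1) : ∑ b : ι → V, ∏ i, F i (b i) ≤ 1 := by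
  rw [← Fintype.prod_sum]
  exact Finset.prod_le_one (fun i _ => Finset.sum_nonneg fun v _ => h0 i v) (fun i _ => h1 i)

lemma partEntropy_nonneg {X : Type*} [MeasurableSpace X] (T : X → X) (μ : Measure X)
    [IsProbabilityMeasure μ] (P : Finset (Set X)) (n : ℕ) : 0 ≤ partEntropy T μ P n :=
  Finset.sum_nonneg fun _ _ => Real.negMulLog_nonneg measureReal_nonneg measureReal_le_one

/-- Core of the Kolmogorov–Sinai theorem. -/
lemma ks_core (hm : 0 < m) {μ : Measure (SymbSp m)} [IsProbabilityMeasure μ]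
    (hμ : μ.map shift = μ) {ι : Type*} [Fintype ι] [Nonempty ι] [DecidableEq ι]
    (x0 : SymbSp m → ι)
    (hx0 : ∀ a, MeasurableSet (x0 ⁻¹' {a})) {N : ℕ} (hN : 0 < N) {ε : ℝ} (hε : 0 < ε) :
    ∃ n : ℕ, ∑ c : Fin (n + 1) → ι, Real.negMulLog
      (μ.real ((fun ω (i : Fin (n + 1)) => x0 (shift^[(i : ℕ)] ω)) ⁻¹' {c}))
        ≤ (n + 1 : ℝ) * (Hc μ N / N + ε) := by
  set ε1 := ε / 4 with hε1
  have heps_pos : 0 < ε1 := by positivity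
  -- choice of δ
  obtain ⟨δ, h0, h1, hδ⟩ : ∃ δ : ℝ, 0 < δ ∧ δ < 1 ∧ -Real.log (1 - δ) ≤ ε1 := by
    refine ⟨1 - Real.exp (-ε1), ?_, ?_, ?_⟩
    · have : Real.exp (-ε1) < 1 := by
        rw [← Real.exp_zero]; exact Real.exp_lt_exp.2 (by linarith)
      linarith
    · have := Real.exp_pos (-ε1); linarith
    · simp
  set p : ℝ := ((Fintype.card ι : ℕ) : ℝ) with hp
  have hp1 : 1 ≤ p := by
    rw [hp]; exact_mod_cast Fintype.card_pos (α := ι)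
  set L : ℝ := -Real.log (δ / p) with hL
  have hL0 : 0 ≤ L := by
    rw [hL]
    have : Real.log (δ / p) ≤ 0 := Real.log_nonpos (by positivity)
      ((div_le_one (by linarith)).2 (by linarith))
    linarith
  obtain ⟨k, φ, hφ⟩ := approx_cyl μ x0 hx0 (η := ε1 / (L + 1)) (by positivity)
  have hHc := Hc_nonneg μ N
  obtain ⟨R', hR'⟩ := exists_nat_gt (k * (Hc μ N + ε1) / ε1)
  rw [div_lt_iff₀ heps_pos] at hR'
  obtain ⟨n, hn⟩ : ∃ n, n + 1 = (R' + 1) * N :=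
    ⟨(R' + 1) * N - 1, Nat.sub_add_cancel (Nat.succ_le_of_lt (by positivity))⟩
  set R := R' + 1 + k with hR
  have hRN : n + 1 + k ≤ R * N := by
    rw [hR, add_mul, hn]
    have : k * 1 ≤ k * N := Nat.mul_le_mul_left k hN
    omega
  have hpos : ∀ (i : Fin (n + 1)) (j : Fin k), (i + j : ℕ) / N < R := by
    intro i j
    rw [Nat.div_lt_iff_lt_mul hN]
    have := i.2; have := j.2; omega
  set X : SymbSp m → (Fin (n + 1) → ι) := fun ω i => x0 (shift^[(i : ℕ)] ω) with hX
  let Y : SymbSp m → (Fin R → Fin N → Fin m) := fun ω r j => ω (j + r * N)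
  let ψ : Fin (n + 1) → (Fin R → Fin N → Fin m) → ι := fun i b =>
    φ (fun j => b ⟨(i + j : ℕ) / N, hpos i j⟩ ⟨(i + j : ℕ) % N, Nat.mod_lt _ hN⟩)
  let r : ι → ι → ℝ := fun x y => if x = y then 1 - δ else δ / p
  have hr0 : ∀ x y, 0 < r x y := by
    intro x y
    simp only [r]
    split_ifs
    · linarith
    · positivity
  have hr1 : ∀ y, ∑ x, r x y ≤ 1 := by
    intro y
    calc ∑ x, r x y ≤ ∑ x, ((if x = y then 1 - δ else 0) + δ / p) := by
          refine Finset.sum_le_sum fun x _ => ?_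
          have : 0 ≤ δ / p := by positivity
          simp only [r]
          split_ifs <;> linarith
      _ = 1 := by
          rw [Finset.sum_add_distrib, Finset.sum_ite_eq' Finset.univ y (fun _ => 1 - δ)]
          simp only [Finset.mem_univ, if_true, Finset.sum_const, Finset.card_univ, nsmul_eq_mul]
          rw [← hp]
          field_simp
          ring
  have hmX : ∀ a, MeasurableSet (X ⁻¹' {a}) := by
    intro a
    have : X ⁻¹' {a} = ⋂ i : Fin (n + 1), (shift^[(i : ℕ)]) ⁻¹' (x0 ⁻¹' {a i}) := by
      ext ω; simp [hX, funext_iff]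
    rw [this]
    exact MeasurableSet.iInter fun i => (measurable_shift.iterate _) (hx0 _)
  have hmY : ∀ b, MeasurableSet (Y ⁻¹' {b}) := by
    intro b
    have : Measurable Y := measurable_pi_lambda _ fun r => measurable_pi_lambda _ fun j =>
      measurable_pi_apply _
    exact this (measurableSet_singleton b)
  have hψY : ∀ i ω, ψ i (Y ω) = φ (pre k (shift^[(i : ℕ)] ω)) := by
    intro i ω
    simp only [ψ, Y]
    congr 1
    funext j
    simp only [pre]
    rw [shift_iter]
    congr 1
    have := Nat.mod_add_div (i + j : ℕ) N
    rw [mul_comm ((i + j : ℕ) / N)]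
    omega
  have hYpre : ∀ (s : Fin R) ω, Y ω s = pre N (shift^[(s : ℕ) * N] ω) := by
    intro s ω
    funext j
    simp only [Y, pre]
    rw [shift_iter]
  have key := gibbs_joint μ X hmX Y hmY
    (fun a b => (∏ s, spi μ N δ (b s)) * ∏ i, r (a i) (ψ i b))
    (fun a b => mul_pos (Finset.prod_pos fun s _ => spi_pos hm μ N h0 h1 _)
      (Finset.prod_pos fun i _ => hr0 _ _))
    (by
      calc ∑ b, ∑ a : Fin (n + 1) → ι, (∏ s, spi μ N δ (b s)) * ∏ i, r (a i) (ψ i b)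
          ≤ ∑ b : Fin R → Fin N → Fin m, (∏ s, spi μ N δ (b s)) * 1 := by
            refine Finset.sum_le_sum fun b _ => ?_
            rw [← Finset.mul_sum]
            refine mul_le_mul_of_nonneg_left ?_
              (Finset.prod_nonneg fun s _ => (spi_pos hm μ N h0 h1 _).le)
            exact sum_prod_le_one (fun i x => r x (ψ i b)) (fun i x => (hr0 _ _).le)
              (fun i => hr1 _)
        _ ≤ 1 := by
            simp only [mul_one]
            exact sum_prod_le_one (fun (_ : Fin R) v => spi μ N δ v)
              (fun _ v => (spi_pos hm μ N h0 h1 _).le) (fun _ => (spi_sum hm μ N δ).le))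
  refine ⟨n, key.trans ?_⟩
  let F : SymbSp m → ℝ := fun ω => -Real.log (spi μ N δ (pre N ω))
  let ρ : SymbSp m → ℝ := fun ω => -Real.log (r (x0 ω) (φ (pre k ω)))
  have hFint : Integrable F μ := (fin_int μ (pre N) (meas_pre N) (fun w => -Real.log (spi μ N δ w))).1
  have hmx : ∀ c : ι × (Fin k → Fin m), MeasurableSet ((fun ω => (x0 ω, pre k ω)) ⁻¹' {c}) := by
    rintro ⟨a, b⟩
    have : ((fun ω => (x0 ω, pre k ω)) ⁻¹' {(a, b)}) = x0 ⁻¹' {a} ∩ pre k ⁻¹' {b} := by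
      ext ω; simp
    rw [this]
    exact (hx0 a).inter (meas_pre k b)
  have hρint : Integrable ρ μ :=
    (fin_int μ (fun ω => (x0 ω, pre k ω)) hmx (fun c => -Real.log (r c.1 (φ c.2)))).1
  have hp : ∀ j, MeasurePreserving (shift^[j] : SymbSp m → SymbSp m) μ μ := fun j =>
    (⟨measurable_shift, hμ⟩ : MeasurePreserving (shift : SymbSp m → SymbSp m) μ μ).iterate j
  have hFj : ∀ j, Integrable (fun ω => F (shift^[j] ω)) μ := fun j =>
    (hp j).integrable_comp_of_integrable hFint
  have hρj : ∀ j, Integrable (fun ω => ρ (shift^[j] ω)) μ := fun j =>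
    (hp j).integrable_comp_of_integrable hρint
  have hsplit : ∀ ω, -Real.log ((∏ s, spi μ N δ (Y ω s)) * ∏ i, r (X ω i) (ψ i (Y ω))) =
      ∑ s : Fin R, F (shift^[(s : ℕ) * N] ω) + ∑ i : Fin (n + 1), ρ (shift^[(i : ℕ)] ω) := by
    intro ω
    rw [Real.log_mul (Finset.prod_pos fun s _ => spi_pos hm μ N h0 h1 _).ne'
      (Finset.prod_pos fun i _ => hr0 _ _).ne', Real.log_prod fun s _ => (spi_pos hm μ N h0 h1 _).ne',
      Real.log_prod fun i _ => (hr0 _ _).ne', neg_add, ← Finset.sum_neg_distrib,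
      ← Finset.sum_neg_distrib]
    congr 1
    · refine Finset.sum_congr rfl fun s _ => ?_
      simp only [F, hYpre]
    · refine Finset.sum_congr rfl fun i _ => ?_
      simp only [ρ, hψY, hX]
  have hFle : ∫ ω, F ω ∂μ ≤ Hc μ N + ε1 := (spi_int hm μ N h0 h1).trans (by linarith)
  have hρle : ∫ ω, ρ ω ∂μ ≤ ε1 + ε1 := by
    have hbad : MeasurableSet {ω | x0 ω ≠ φ (pre k ω)} := by
      have : {ω | x0 ω ≠ φ (pre k ω)} = ⋃ c ∈ {c : ι × (Fin k → Fin m) | c.1 ≠ φ c.2},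
          ((fun ω => (x0 ω, pre k ω)) ⁻¹' {c}) := by
        ext ω; simp
      rw [this]
      exact MeasurableSet.biUnion (Set.to_countable _) fun c _ => hmx c
    have hle : ∀ ω, ρ ω ≤ ε1 + ({ω | x0 ω ≠ φ (pre k ω)}).indicator (fun _ => L) ω := by
      intro ω
      by_cases h : x0 ω = φ (pre k ω)
      · rw [indicator_of_notMem (by simpa using h)]
        simp only [ρ, r, if_pos h]
        linarith
      · rw [indicator_of_mem (show ω ∈ {ω | x0 ω ≠ φ (pre k ω)} from h)]
        simp only [ρ, r, if_neg h]
        linarith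
    have hi : Integrable (({ω | x0 ω ≠ φ (pre k ω)}).indicator (fun _ => L)) μ :=
      (integrable_const L).indicator hbad
    calc ∫ ω, ρ ω ∂μ ≤ ∫ ω, (ε1 + ({ω | x0 ω ≠ φ (pre k ω)}).indicator (fun _ => L) ω) ∂μ :=
          integral_mono hρint ((integrable_const _).add hi) hle
      _ = ε1 + μ.real {ω | x0 ω ≠ φ (pre k ω)} * L := by
          rw [integral_add (integrable_const _) hi, integral_indicator_const _ hbad]
          simp
      _ ≤ ε1 + ε1 := by
          have h2 := mul_le_mul_of_nonneg_right hφ hL0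
          have h3 : ε1 / (L + 1) * L ≤ ε1 := by
            rw [div_mul_eq_mul_div, div_le_iff₀ (by linarith)]
            nlinarith
          linarith
  calc ∫ ω, -Real.log ((∏ s, spi μ N δ (Y ω s)) * ∏ i, r (X ω i) (ψ i (Y ω))) ∂μ
      = ∫ ω, (∑ s : Fin R, F (shift^[(s : ℕ) * N] ω) + ∑ i : Fin (n + 1), ρ (shift^[(i : ℕ)] ω)) ∂μ := by
        simp_rw [hsplit]
    _ = ∑ s : Fin R, ∫ ω, F (shift^[(s : ℕ) * N] ω) ∂μ
          + ∑ i : Fin (n + 1), ∫ ω, ρ (shift^[(i : ℕ)] ω) ∂μ := by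
        rw [integral_add (integrable_finsetSum _ fun s _ => hFj _)
          (integrable_finsetSum _ fun i _ => hρj _), integral_finsetSum _ fun s _ => hFj _,
          integral_finsetSum _ fun i _ => hρj _]
    _ = R * ∫ ω, F ω ∂μ + (n + 1 : ℝ) * ∫ ω, ρ ω ∂μ := by
        simp_rw [int_shift hμ F hFint.aestronglyMeasurable, int_shift hμ ρ hρint.aestronglyMeasurable]
        simp
    _ ≤ R * (Hc μ N + ε1) + (n + 1 : ℝ) * (ε1 + ε1) := by gcongr
    _ ≤ (n + 1 : ℝ) * (Hc μ N / N + ε) := by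
        have hn' : (n + 1 : ℝ) = (R' + 1) * N := by exact_mod_cast hn
        have hN1 : (1:ℝ) ≤ N := by exact_mod_cast hN
        have hRr : (R : ℝ) = R' + 1 + k := by rw [hR]; push_cast; ring
        rw [hRr, hn']
        have e1 : ((R' : ℝ) + 1) * N * (Hc μ N / N + ε) = (R' + 1) * Hc μ N + (R' + 1) * N * ε := by
          field_simp
        rw [e1]
        have e2 : ε = 4 * ε1 := by rw [hε1]; ring
        rw [e2]
        have hR0 : (0:ℝ) ≤ R' := Nat.cast_nonneg _
        have : ((R':ℝ) + 1) * 1 ≤ (R' + 1) * N := by gcongr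
        nlinarith

lemma ks {μ : Measure (SymbSp m)} (hm : 0 < m) [IsProbabilityMeasure μ] (hμ : μ.map shift = μ)
    {P : Finset (Set (SymbSp m))} (hP : IsMeasPartition P) {N : ℕ} (hN : 0 < N) :
    ⨅ n : ℕ, partEntropy shift μ P (n + 1) / (n + 1) ≤ Hc μ N / N := by
  classical
  obtain ⟨hPm, hPd, hPu⟩ := hP
  have hex : ∀ ω : SymbSp m, ∃ s : {s // s ∈ P}, ω ∈ (s : Set (SymbSp m)) := by
    intro ω
    have : ω ∈ ⋃ s ∈ P, s := by rw [hPu]; trivial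
    obtain ⟨s, hs, h⟩ := mem_iUnion₂.1 this
    exact ⟨⟨s, hs⟩, h⟩
  choose x0 hx0 using hex
  have hx0' : ∀ ω (s : {s // s ∈ P}), x0 ω = s ↔ ω ∈ (s : Set (SymbSp m)) := by
    intro ω s
    constructor
    · rintro rfl; exact hx0 ω
    · intro h
      by_contra hne
      have hne' : ((x0 ω : Set (SymbSp m))) ≠ s := fun h => hne (Subtype.ext h)
      exact Set.disjoint_left.1 (hPd (x0 ω).2 s.2 hne') (hx0 ω) h
  have hpre : ∀ s : {s // s ∈ P}, x0 ⁻¹' {s} = s := by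
    intro s; ext ω; exact hx0' ω s
  have : Nonempty {s // s ∈ P} := ⟨x0 (fun _ => ⟨0, hm⟩)⟩
  refine le_of_forall_pos_le_add fun ε hε => ?_
  obtain ⟨n, hn⟩ := ks_core hm hμ x0 (fun s => by rw [hpre]; exact hPm s s.2) hN hε
  refine (ciInf_le ⟨0, ?_⟩ n).trans ?_
  · rintro _ ⟨k, rfl⟩
    exact div_nonneg (partEntropy_nonneg _ _ _ _) (by positivity)
  · rw [div_le_iff₀ (by positivity), mul_comm]
    refine le_trans (le_of_eq ?_) hn
    unfold partEntropy
    refine Finset.sum_congr rfl fun c _ => ?_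
    congr 2
    congr 1
    ext ω
    simp [funext_iff, hx0']

lemma partEntropy_cyl (hm : 0 < m) (μ : Measure (SymbSp m)) [DecidableEq (Set (SymbSp m))] (n : ℕ) :
    partEntropy shift μ (Finset.univ.image fun i : Fin m => {ω : SymbSp m | ω 0 = i}) n = Hc μ n := by
  have hinj : Function.Injective (fun i : Fin m => {ω : SymbSp m | ω 0 = i}) := by
    intro i j h
    have : (fun _ => i : SymbSp m) ∈ {ω : SymbSp m | ω 0 = j} := by
      rw [← show {ω : SymbSp m | ω 0 = i} = {ω : SymbSp m | ω 0 = j} from h]; rfl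
    exact this
  let e : Fin m ≃ {s // s ∈ Finset.univ.image fun i : Fin m => {ω : SymbSp m | ω 0 = i}} :=
    Equiv.ofBijective (fun i => ⟨{ω : SymbSp m | ω 0 = i}, Finset.mem_image_of_mem _ (Finset.mem_univ i)⟩)
      ⟨fun i j h => hinj (Subtype.ext_iff.1 h), fun ⟨s, hs⟩ => by
        obtain ⟨i, -, hi⟩ := Finset.mem_image.1 hs
        exact ⟨i, Subtype.ext hi⟩⟩
  unfold partEntropy Hc
  rw [← (Equiv.arrowCongr (Equiv.refl (Fin n)) e).sum_comp]
  refine Finset.sum_congr rfl fun w _ => ?_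
  congr 2
  congr 1
  ext ω
  have h : ∀ i : Fin n, (ω ∈ (shift^[(i : ℕ)]) ⁻¹' ((e (w i)) : Set (SymbSp m))) ↔ ω i = w i := by
    intro i
    change (shift^[(i : ℕ)] ω) 0 = w i ↔ _
    rw [shift_iter, zero_add]
  rw [mem_iInter, mem_preimage, mem_singleton_iff, funext_iff]
  exact forall_congr' h

lemma cyl_isMeasPartition [DecidableEq (Set (SymbSp m))] :
    IsMeasPartition (Finset.univ.image fun i : Fin m => {ω : SymbSp m | ω 0 = i}) := by
  refine ⟨?_, ?_, ?_⟩
  · intro s hs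
    obtain ⟨i, -, rfl⟩ := Finset.mem_image.1 hs
    change MeasurableSet ((fun ω : SymbSp m => ω 0) ⁻¹' {i})
    exact (measurable_pi_apply 0) (measurableSet_singleton i)
  · intro s hs t ht hst
    obtain ⟨i, -, rfl⟩ := Finset.mem_image.1 hs
    obtain ⟨j, -, rfl⟩ := Finset.mem_image.1 ht
    rw [Function.onFun, Set.disjoint_left]
    intro ω h1 h2
    apply hst
    have h1' : ω 0 = i := h1
    have h2' : ω 0 = j := h2
    rw [← h1', ← h2']
  · ext ω; simp

lemma entropy_le {μ : Measure (SymbSp m)} (hm : 0 < m) [IsProbabilityMeasure μ]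
    (hμ : μ.map shift = μ) {N : ℕ} (hN : 0 < N) : metricEntropy shift μ ≤ Hc μ N / N := by
  unfold metricEntropy
  classical
  have : Nonempty {P : Finset (Set (SymbSp m)) // IsMeasPartition P} := ⟨⟨_, cyl_isMeasPartition⟩⟩
  exact ciSup_le fun P => ks hm hμ P.2 hN

lemma le_entropy {μ : Measure (SymbSp m)} (hm : 0 < m) [IsProbabilityMeasure μ]
    (hμ : μ.map shift = μ) {a : ℝ} (ha : ∀ n : ℕ, a * (n + 1) ≤ Hc μ (n + 1)) :
    a ≤ metricEntropy shift μ := by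
  unfold metricEntropy
  classical
  refine le_trans ?_ (le_ciSup (f := fun P : {P : Finset (Set (SymbSp m)) // IsMeasPartition P} =>
    ⨅ n : ℕ, partEntropy shift μ (P : Finset (Set (SymbSp m))) (n + 1) / (n + 1))
    ⟨Hc μ 1 / (1 : ℕ), ?_⟩ ⟨_, cyl_isMeasPartition⟩)
  · refine le_ciInf fun n => ?_
    rw [le_div_iff₀ (by positivity)]
    simp only
    rw [partEntropy_cyl hm]
    exact ha n
  · rintro _ ⟨P, rfl⟩
    exact ks hm hμ P.2 one_pos

end


/-! ### Limits of discrete measures -/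

section
variable {m : ℕ}

lemma exists_limit {ι : ℕ → Type} [∀ k, Fintype (ι k)] (p : ∀ k, ι k → ℝ)
    (hp : ∀ k i, 0 ≤ p k i) (hp1 : ∀ k, ∑ i, p k i = 1) (x : ∀ k, ι k → SymbSp m) :
    ∃ μ : Measure (SymbSp m), IsProbabilityMeasure μ ∧ ∀ φ : SymbSp m → ℝ, Continuous φ →
      Tendsto (fun k => ∑ i, p k i * φ (x k i)) (hyperfilter ℕ) (𝓝 (∫ ω, φ ω ∂μ)) := by
  let M : ℕ → Measure (SymbSp m) := fun k =>
    ∑ i, ENNReal.ofReal (p k i) • Measure.dirac (x k i)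
  have hM : ∀ k, IsProbabilityMeasure (M k) := by
    intro k
    constructor
    simp only [M, Measure.coe_finsetSum, Finset.sum_apply, Measure.smul_apply, measure_univ,
      smul_eq_mul, mul_one]
    rw [← ENNReal.ofReal_sum_of_nonneg (fun i _ => hp k i), hp1 k, ENNReal.ofReal_one]
  have hinteg : ∀ k (φ : SymbSp m → ℝ), ∫ ω, φ ω ∂(M k) = ∑ i, p k i * φ (x k i) := by
    intro k φ
    simp only [M]
    rw [integral_finsetSum_measure]
    · refine Finset.sum_congr rfl fun i _ => ?_
      rw [integral_smul_measure, integral_dirac, ENNReal.toReal_ofReal (hp k i), smul_eq_mul]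
    · intro i _
      refine Integrable.smul_measure ?_ ENNReal.ofReal_ne_top
      exact integrable_dirac (by simp [enorm_lt_top])
  let P : ℕ → ProbabilityMeasure (SymbSp m) := fun k => ⟨M k, hM k⟩
  obtain ⟨ν, -, hν⟩ := isCompact_univ.ultrafilter_le_nhds' ((hyperfilter ℕ).map P)
    Filter.univ_mem
  have hν' : Tendsto P (hyperfilter ℕ) (𝓝 ν) := hν
  refine ⟨ν, inferInstance, fun φ hφ => ?_⟩
  have := (ProbabilityMeasure.tendsto_iff_forall_integral_tendsto.1 hν')
    (BoundedContinuousFunction.mkOfCompact ⟨φ, hφ⟩)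
  simpa [P, hinteg] using this

lemma sum_range_blocks (a : ℕ → ℝ) (R q : ℕ) :
    ∑ i ∈ Finset.range (R * q), a i = ∑ j ∈ Finset.range q, ∑ r ∈ Finset.range R, a (j + r * q) := by
  induction R with
  | zero => simp
  | succ R ih =>
    rw [add_mul, one_mul, Finset.sum_range_add, ih]
    simp_rw [Finset.sum_range_succ]
    rw [Finset.sum_add_distrib]
    congr 1
    refine Finset.sum_congr rfl fun j _ => ?_
    rw [add_comm]

/-- Misiurewicz type inequality -/
lemma misiu (hm : 0 < m) {n q : ℕ} (hq : 0 < q) (p : (Fin n → Fin m) → ℝ) (hp : ∀ w, 0 ≤ p w)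
    (hp1 : ∑ w, p w = 1) (x : (Fin n → Fin m) → SymbSp m) (hx : ∀ w, pre n (x w) = w)
    (π : (Fin q → Fin m) → ℝ) (hπ : ∀ v, 0 < π v) (hπ1 : ∑ v, π v ≤ 1) {B : ℝ}
    (h0B : ∀ v, 0 ≤ -Real.log (π v)) (hB : ∀ v, -Real.log (π v) ≤ B) :
    q * ∑ w, Real.negMulLog (p w) ≤ q * (q * Real.log m) + q * B +
      ∑ w, p w * ∑ j ∈ Finset.range n, -Real.log (π (pre q (shift^[j] (x w)))) := by
  set R := n / q + 1 with hR
  have hmR : (0:ℝ) < m := by exact_mod_cast hm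
  have hRq : n ≤ R * q := by
    rw [hR]; have := Nat.div_add_mod n q; have := Nat.mod_lt n hq; nlinarith
  have hRq' : R * q ≤ n + q := by
    rw [hR]; have := Nat.div_mul_le_self n q; nlinarith
  let F : SymbSp m → ℝ := fun ω => -Real.log (π (pre q ω))
  have key : ∀ j ∈ Finset.range q, ∑ w, Real.negMulLog (p w) ≤
      ∑ w, p w * (q * Real.log m + ∑ r ∈ Finset.range R, F (shift^[j + r * q] (x w))) := by
    intro j hj
    rw [Finset.mem_range] at hj
    have h := gibbs_inj p hp hp1
      (fun w => (pre q (x w), fun r : Fin R => pre q (shift^[j + r * q] (x w))))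
      (by
        intro w w' h
        simp only [Prod.mk.injEq] at h
        obtain ⟨h1, h2⟩ := h
        rw [← hx w, ← hx w']
        funext i
        change x w i = x w' i
        by_cases hij : (i : ℕ) < j
        · exact congrFun h1 ⟨i, by omega⟩
        · have hr : ((i : ℕ) - j) / q < R := by
            rw [Nat.div_lt_iff_lt_mul hq]; have := i.2; omega
          have h3 := congrFun (congrFun h2 ⟨_, hr⟩) ⟨((i : ℕ) - j) % q, Nat.mod_lt _ hq⟩
          simp only [pre, shift_iter] at h3
          have h4 : ((i : ℕ) - j) % q + (j + ((i : ℕ) - j) / q * q) = i := by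
            have := Nat.mod_add_div ((i : ℕ) - j) q
            rw [mul_comm] at this
            omega
          rwa [h4] at h3)
      (fun v => ((m : ℝ) ^ q)⁻¹ * ∏ r, π (v.2 r))
      (fun v => mul_pos (by positivity) (Finset.prod_pos fun r _ => hπ _))
      (by
        rw [Fintype.sum_prod_type]
        simp_rw [← Finset.mul_sum]
        simp only [Finset.sum_const, Finset.card_univ, nsmul_eq_mul]
        have := sum_prod_le_one (fun (_ : Fin R) v => π v) (fun _ v => (hπ v).le) (fun _ => hπ1)
        simp only [Fintype.card_fun, Fintype.card_fin, Nat.cast_pow]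
        rw [inv_mul_cancel_left₀ (by positivity)]
        exact this)
    refine h.trans (le_of_eq ?_)
    refine Finset.sum_congr rfl fun w _ => ?_
    congr 1
    rw [Real.log_mul (by positivity) (Finset.prod_pos fun r _ => hπ _).ne',
      Real.log_prod fun r _ => (hπ _).ne', Real.log_inv, Real.log_pow, neg_add, neg_neg,
      ← Finset.sum_neg_distrib, Finset.sum_range]
  have h2 := Finset.sum_le_sum key
  rw [Finset.sum_const, Finset.card_range, nsmul_eq_mul, Finset.sum_comm] at h2
  refine h2.trans ?_
  calc ∑ w, ∑ j ∈ Finset.range q,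
        p w * (q * Real.log m + ∑ r ∈ Finset.range R, F (shift^[j + r * q] (x w)))
      ≤ ∑ w, p w * (q * (q * Real.log m) + q * B +
          ∑ j ∈ Finset.range n, F (shift^[j] (x w))) := by
        refine Finset.sum_le_sum fun w _ => ?_
        rw [← Finset.mul_sum]
        refine mul_le_mul_of_nonneg_left ?_ (hp w)
        rw [Finset.sum_add_distrib, ← sum_range_blocks (fun i => F (shift^[i] (x w)))]
        rw [Finset.sum_const, Finset.card_range, nsmul_eq_mul]
        have : ∑ i ∈ Finset.range (R * q), F (shift^[i] (x w)) ≤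
            ∑ i ∈ Finset.range (n + q), F (shift^[i] (x w)) :=
          Finset.sum_le_sum_of_subset_of_nonneg (Finset.range_mono hRq') (fun _ _ _ => h0B _)
        rw [Finset.sum_range_add] at this
        have h4 : ∑ i ∈ Finset.range q, F (shift^[n + i] (x w)) ≤ ∑ i ∈ Finset.range q, B :=
          Finset.sum_le_sum fun i _ => hB _
        rw [Finset.sum_const, Finset.card_range, nsmul_eq_mul] at h4
        linarith
    _ = _ := by
        simp_rw [mul_add (p _)]
        rw [Finset.sum_add_distrib, Finset.sum_add_distrib, ← Finset.sum_mul, ← Finset.sum_mul, hp1]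
        ring


/-- words of length `n` with good Birkhoff averages -/
def goodW (S : PCSystem m) {E : Type*} [NormedAddCommGroup E] [NormedSpace ℝ E]
    (f : SymbSp m → E) (α : E) (c ε : ℝ) (n : ℕ) : Set (Fin n → Fin m) :=
  pre n '' {ω | ‖birkhoff shift f n ω - α‖ ≤ ε ∧ c ≤ birkhoff shift S.g n ω}

lemma birkhoff_eq (φ : SymbSp m → ℝ) (n : ℕ) (ω : SymbSp m) :
    birkhoff shift φ n ω = (n : ℝ)⁻¹ * birkhoffSum shift φ n ω := rfl

lemma proj_birkhoff {d : ℕ} (f : SymbSp m → EuclideanSpace ℝ (Fin d)) (i : Fin d) (n : ℕ)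
    (ω : SymbSp m) : birkhoff shift (fun ω => f ω i) n ω = (birkhoff shift f n ω) i := by
  simp [birkhoff]

lemma integrable_cont {E : Type*} [NormedAddCommGroup E] [NormedSpace ℝ E]
    [SecondCountableTopology E] (μ : Measure (SymbSp m)) [IsProbabilityMeasure μ]
    (φ : SymbSp m → E) (hφ : Continuous φ) : Integrable φ μ := by
  borelize E
  exact (BoundedContinuousFunction.mkOfCompact ⟨φ, hφ⟩).integrable μ

lemma integral_proj {d : ℕ} (μ : Measure (SymbSp m)) [IsProbabilityMeasure μ]
    (f : SymbSp m → EuclideanSpace ℝ (Fin d)) (hf : Continuous f) (i : Fin d) :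
    ∫ ω, f ω i ∂μ = (∫ ω, f ω ∂μ) i :=
  ContinuousLinearMap.integral_comp_comm (EuclideanSpace.proj (𝕜 := ℝ) i)
    (integrable_cont μ f hf)

/-- entropy of the weights -/
lemma entropy_weights {ι : Type*} [Fintype ι] (a : ι → ℝ) (ha : ∀ i, 0 ≤ a i) (l : ι → ℝ)
    (t : ℝ) (hal : ∀ i, a i ≠ 0 → Real.log (a i) = -t * l i) (hZ : 1 ≤ ∑ i, a i) :
    t * ∑ i, (a i / ∑ j, a j) * l i ≤ ∑ i, Real.negMulLog (a i / ∑ j, a j) := by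
  set Z := ∑ j, a j with hZd
  rw [Finset.mul_sum]
  refine Finset.sum_le_sum fun i _ => ?_
  by_cases h : a i = 0
  · simp [h]
  · rw [Real.negMulLog, Real.log_div h (by linarith), hal i h]
    have h1 : 0 ≤ Real.log Z := Real.log_nonneg hZ
    have h2 : 0 ≤ a i / Z := div_nonneg (ha i) (by linarith)
    nlinarith [mul_nonneg h2 h1]

lemma exists_ext (hm : 0 < m) {n : ℕ} (w : Fin n → Fin m) : ∃ ω : SymbSp m, pre n ω = w :=
  ⟨fun i => if h : i < n then w ⟨i, h⟩ else ⟨0, hm⟩, by funext i; simp [pre]⟩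

lemma upper_key (S : PCSystem m) {d : ℕ} (f : SymbSp m → EuclideanSpace ℝ (Fin d))
    (hf : Continuous f) (α : EuclideanSpace ℝ (Fin d)) {t c : ℝ} (ht : 0 < t) (hc : 0 < c)
    (hsup : ∀ μ : Measure (SymbSp m), IsProbabilityMeasure μ → μ.map shift = μ →
      (∫ ω, f ω ∂μ) = α → 0 < S.lyapSymb μ → metricEntropy shift μ < t * S.lyapSymb μ) :
    ∃ ε > 0, ∃ N, ∀ n ≥ N, ∑ w, (goodW S f α c ε n).indicator
      (fun w => S.len (List.ofFn w) ^ t) w ≤ 1 := by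
  by_contra! hcon
  have h1 : ∀ k : ℕ, ∃ n ≥ k + 1, 1 < ∑ w, (goodW S f α c (1 / ((k : ℝ) + 1)) n).indicator
      (fun w => S.len (List.ofFn w) ^ t) w := fun k => hcon _ (by positivity) _
  choose n hn hZ using h1
  let W : ∀ k, Set (Fin (n k) → Fin m) := fun k => goodW S f α c (1 / ((k : ℝ) + 1)) (n k)
  have hx : ∀ k (w : Fin (n k) → Fin m), ∃ ω : SymbSp m, pre (n k) ω = w ∧ (w ∈ W k →
      ‖birkhoff shift f (n k) ω - α‖ ≤ 1 / ((k : ℝ) + 1) ∧ c ≤ birkhoff shift S.g (n k) ω) := by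
    intro k w
    by_cases h : w ∈ W k
    · obtain ⟨ω, h1, h2⟩ := h
      exact ⟨ω, h2, fun _ => h1⟩
    · obtain ⟨ω, h1⟩ := exists_ext S.hm w
      exact ⟨ω, h1, fun h2 => absurd h2 h⟩
  choose x hxp hxW using hx
  let a : ∀ k, (Fin (n k) → Fin m) → ℝ := fun k =>
    (W k).indicator (fun w => S.len (List.ofFn w) ^ t)
  have ha : ∀ k w, 0 ≤ a k w := fun k w =>
    indicator_nonneg (fun w _ => Real.rpow_nonneg (S.len_pos _).le _) w
  have hZ' : ∀ k, 1 < ∑ w, a k w := hZ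
  let p : ∀ k, (Fin (n k) → Fin m) → ℝ := fun k w => a k w / ∑ v, a k v
  have hp : ∀ k w, 0 ≤ p k w := fun k w => div_nonneg (ha k w) (by linarith [hZ' k])
  have hp1 : ∀ k, ∑ w, p k w = 1 := by
    intro k
    simp only [p]
    rw [← Finset.sum_div, div_self (by linarith [hZ' k])]
  have hpW : ∀ k w, w ∉ W k → p k w = 0 := by
    intro k w h
    simp only [p, a, indicator_of_notMem h, zero_div]
  have hnpos : ∀ k, (0:ℝ) < n k := fun k => by
    have := hn k; exact_mod_cast (by omega : 0 < n k)
  -- limit measure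
  obtain ⟨μ, hμp, hμ⟩ := exists_limit (ι := fun k => (Fin (n k) → Fin m) × Fin (n k))
    (fun k i => p k i.1 * (n k : ℝ)⁻¹) (fun k i => mul_nonneg (hp k _) (by positivity))
    (fun k => by
      rw [Fintype.sum_prod_type]
      simp only [Finset.sum_const, Finset.card_univ, Fintype.card_fin, nsmul_eq_mul]
      rw [← hp1 k]
      refine Finset.sum_congr rfl fun w _ => ?_
      have := hnpos k
      field_simp)
    (fun k i => shift^[(i.2 : ℕ)] (x k i.1))
  have hlim : ∀ φ : SymbSp m → ℝ, Continuous φ →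
      Tendsto (fun k => ∑ w, p k w * birkhoff shift φ (n k) (x k w)) (hyperfilter ℕ)
        (𝓝 (∫ ω, φ ω ∂μ)) := by
    intro φ hφ
    refine (hμ φ hφ).congr fun k => ?_
    rw [Fintype.sum_prod_type]
    refine Finset.sum_congr rfl fun w _ => ?_
    rw [birkhoff_eq, birkhoffSum, Finset.sum_range, Finset.mul_sum, Finset.mul_sum]
    refine Finset.sum_congr rfl fun w _ => ?_
    ring
  have hle : (hyperfilter ℕ : Filter ℕ) ≤ atTop := Nat.hyperfilter_le_atTop
  have hklim : Tendsto (fun k : ℕ => 1 / ((k : ℝ) + 1)) (hyperfilter ℕ) (𝓝 0) :=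
    tendsto_one_div_add_atTop_nhds_zero_nat.mono_left hle
  have hninv : Tendsto (fun k : ℕ => (n k : ℝ)⁻¹) (hyperfilter ℕ) (𝓝 0) := by
    refine squeeze_zero (fun k => by positivity) (fun k => ?_) hklim
    rw [inv_eq_one_div]
    refine one_div_le_one_div_of_le (by positivity) ?_
    exact_mod_cast hn k
  -- integral of f
  have hfα : (∫ ω, f ω ∂μ) = α := by
    ext i
    rw [← integral_proj μ f hf i]
    have hci : Continuous fun ω => f ω i := by fun_prop
    refine tendsto_nhds_unique (hlim _ hci) ?_
    rw [tendsto_iff_norm_sub_tendsto_zero]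
    refine squeeze_zero (fun k => norm_nonneg _) (fun k => ?_) hklim
    have e : ∑ w, p k w * birkhoff shift (fun ω => f ω i) (n k) (x k w) - α i =
        ∑ w, p k w * (birkhoff shift (fun ω => f ω i) (n k) (x k w) - α i) := by
      simp_rw [mul_sub]
      rw [Finset.sum_sub_distrib, ← Finset.sum_mul, hp1, one_mul]
    rw [e]
    calc ‖∑ w, p k w * (birkhoff shift (fun ω => f ω i) (n k) (x k w) - α i)‖
        ≤ ∑ w, p k w * (1 / ((k : ℝ) + 1)) := by
          refine norm_sum_le_of_le _ fun w _ => ?_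
          by_cases h : w ∈ W k
          · rw [norm_mul, Real.norm_of_nonneg (hp k w)]
            refine mul_le_mul_of_nonneg_left ?_ (hp k w)
            rw [proj_birkhoff]
            have := PiLp.norm_apply_le (birkhoff shift f (n k) (x k w) - α) i
            simp only [PiLp.sub_apply] at this
            exact this.trans (hxW k w h).1
          · simp [hpW k w h]
      _ = _ := by rw [← Finset.sum_mul, hp1, one_mul]
  have hlam : c ≤ S.lyapSymb μ := by
    refine ge_of_tendsto (hlim _ S.continuous_g) (Eventually.of_forall fun k => ?_)
    calc c = ∑ w, p k w * c := by rw [← Finset.sum_mul, hp1, one_mul]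
      _ ≤ _ := by
        refine Finset.sum_le_sum fun w _ => ?_
        by_cases h : w ∈ W k
        · exact mul_le_mul_of_nonneg_left (hxW k w h).2 (hp k w)
        · simp [hpW k w h]
  have hinv : μ.map shift = μ := by
    have : IsProbabilityMeasure (μ.map shift) :=
      Measure.isProbabilityMeasure_map measurable_shift.aemeasurable
    refine ext_of_forall_integral_eq_of_IsFiniteMeasure fun φ => ?_
    rw [integral_map measurable_shift.aemeasurable φ.continuous.aestronglyMeasurable]
    refine tendsto_nhds_unique (hlim _ (φ.continuous.comp continuous_shift)) ?_
    have h2 : Tendsto (fun k => ∑ w, p k w * birkhoff shift (fun ω => φ (shift ω)) (n k) (x k w) -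
        ∑ w, p k w * birkhoff shift φ (n k) (x k w)) (hyperfilter ℕ) (𝓝 0) := by
      obtain ⟨B, hB0, hB⟩ := bdd_of_cont φ φ.continuous
      have hz : Tendsto (fun k : ℕ => (n k : ℝ)⁻¹ * (2 * B)) (hyperfilter ℕ) (𝓝 0) := by
        simpa using hninv.mul_const (2 * B)
      refine squeeze_zero_norm (fun k => ?_) hz
      rw [← Finset.sum_sub_distrib]
      calc ‖∑ w, (p k w * birkhoff shift (fun ω => φ (shift ω)) (n k) (x k w) -
            p k w * birkhoff shift φ (n k) (x k w))‖ ≤ ∑ w, p k w * ((n k : ℝ)⁻¹ * (2 * B)) := by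
            refine norm_sum_le_of_le _ fun w _ => ?_
            rw [← mul_sub, norm_mul, Real.norm_of_nonneg (hp k w)]
            refine mul_le_mul_of_nonneg_left ?_ (hp k w)
            rw [birkhoff_eq, birkhoff_eq, ← mul_sub, norm_mul,
              Real.norm_of_nonneg (by positivity : (0:ℝ) ≤ (n k : ℝ)⁻¹)]
            refine mul_le_mul_of_nonneg_left ?_ (by positivity)
            have e : birkhoffSum shift (fun ω => φ (shift ω)) (n k) (x k w) -
                birkhoffSum shift φ (n k) (x k w) = φ (shift^[n k] (x k w)) - φ (x k w) := by
              simp only [birkhoffSum]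
              rw [← Finset.sum_sub_distrib]
              simp_rw [← Function.iterate_succ_apply' shift]
              rw [Finset.sum_range_sub (fun i => φ (shift^[i] (x k w)))]
              simp
            rw [e, Real.norm_eq_abs]
            have b1 := abs_le.1 (hB (shift^[n k] (x k w)))
            have b2 := abs_le.1 (hB (x k w))
            rw [abs_le]; constructor <;> linarith
        _ = _ := by rw [← Finset.sum_mul, hp1, one_mul]
    have h3 := h2.add (hlim _ φ.continuous)
    simpa using h3
  have hlt := hsup μ hμp hinv hfα (hc.trans_le hlam)
  -- entropy lower bound
  have hent : t * S.lyapSymb μ ≤ metricEntropy shift μ := by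
    refine le_entropy S.hm hinv fun q' => ?_
    set q := q' + 1 with hq
    have hq0 : 0 < q := Nat.succ_pos _
    have hqr : (0:ℝ) < q := by exact_mod_cast hq0
    have hstep : ∀ ε1 > 0, ∀ δ : ℝ, 0 < δ → δ < 1 →
        q * (t * (S.lyapSymb μ - ε1)) ≤ Hc μ q - Real.log (1 - δ) := by
      intro ε1 hε1 δ h0 h1
      let F : SymbSp m → ℝ := fun ω => -Real.log (spi μ q δ (pre q ω))
      have hFc : Continuous F :=
        (continuous_of_discreteTopology (f := fun v : Fin q → Fin m => -Real.log (spi μ q δ v))).comp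
          (continuous_pre q)
      obtain ⟨B, hB⟩ : ∃ B, ∀ v : Fin q → Fin m, -Real.log (spi μ q δ v) ≤ B := by
        obtain ⟨B, hB⟩ := (Set.finite_range (fun v : Fin q → Fin m => -Real.log (spi μ q δ v))).bddAbove
        exact ⟨B, fun v => hB ⟨v, rfl⟩⟩
      obtain ⟨N, hN⟩ := S.len_birkhoff hε1
      refine le_trans ?_ (spi_int S.hm μ q h0 h1)
      have hL : Tendsto (fun k => (q:ℝ) * (t * (∑ w, p k w * birkhoff shift S.g (n k) (x k w) - ε1)))
          (hyperfilter ℕ) (𝓝 (q * (t * (S.lyapSymb μ - ε1)))) :=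
        (((hlim _ S.continuous_g).sub_const ε1).const_mul t).const_mul _
      have hRt : Tendsto (fun k => (n k : ℝ)⁻¹ * (q * (q * Real.log m) + q * B) +
          ∑ w, p k w * birkhoff shift F (n k) (x k w)) (hyperfilter ℕ) (𝓝 (∫ ω, F ω ∂μ)) := by
        simpa using (hninv.mul_const (q * (q * Real.log m) + q * B)).add (hlim F hFc)
      refine le_of_tendsto_of_tendsto hL hRt ?_
      have hev : ∀ᶠ k in (hyperfilter ℕ : Filter ℕ), N ≤ k := hle (eventually_ge_atTop N)
      filter_upwards [hev] with k hk
      have hM := misiu S.hm hq0 (p k) (hp k) (hp1 k) (x k) (hxp k) (spi μ q δ)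
        (spi_pos S.hm μ q h0 h1) (spi_sum S.hm μ q δ).le
        (fun v => by
          have := Real.log_nonpos (spi_pos S.hm μ q h0 h1 v).le (spi_le_one S.hm μ q h0 h1 v)
          linarith) hB
      have hE := entropy_weights (a k) (ha k) (fun w => -Real.log (S.len (List.ofFn w))) t
        (by
          intro w hw
          have hw' : w ∈ W k := by
            by_contra h; exact hw (indicator_of_notMem h _)
          simp only [a, indicator_of_mem hw']
          rw [Real.log_rpow (S.len_pos _)]; ring) (hZ' k).le
      have hlen : ∑ w, p k w * birkhoff shift S.g (n k) (x k w) - ε1 ≤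
          (n k : ℝ)⁻¹ * ∑ w, p k w * (-Real.log (S.len (List.ofFn w))) := by
        calc ∑ w, p k w * birkhoff shift S.g (n k) (x k w) - ε1
            = ∑ w, p k w * (birkhoff shift S.g (n k) (x k w) - ε1) := by
              simp_rw [mul_sub]
              rw [Finset.sum_sub_distrib, ← Finset.sum_mul, hp1, one_mul]
          _ ≤ ∑ w, p k w * ((n k : ℝ)⁻¹ * (-Real.log (S.len (List.ofFn w)))) := by
              refine Finset.sum_le_sum fun w _ => mul_le_mul_of_nonneg_left ?_ (hp k w)
              have h4 := (abs_le.1 (hN (n k) (by have := hn k; omega) (x k w))).1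
              have h5 : word (x k w) (n k) = List.ofFn w := by
                conv_rhs => rw [← hxp k w]
                rfl
              rw [h5] at h4
              rw [birkhoff_eq, inv_mul_eq_div, inv_mul_eq_div, sub_le_iff_le_add,
                div_add' _ _ _ (hnpos k).ne']
              gcongr
              linarith
          _ = _ := by
              rw [Finset.mul_sum]
              refine Finset.sum_congr rfl fun w _ => ?_
              ring
      have hni : (0:ℝ) ≤ (n k : ℝ)⁻¹ := by positivity
      have h6 := mul_le_mul_of_nonneg_left hM hni
      have h7 : ∑ w, p k w * birkhoff shift F (n k) (x k w) = (n k : ℝ)⁻¹ *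
          ∑ w, p k w * ∑ j ∈ Finset.range (n k), -Real.log (spi μ q δ (pre q (shift^[j] (x k w)))) := by
        rw [Finset.mul_sum]
        refine Finset.sum_congr rfl fun w _ => ?_
        rw [birkhoff_eq, birkhoffSum]
        ring
      rw [h7, ← mul_add]
      refine le_trans ?_ h6
      have h8 : t * ((n k : ℝ)⁻¹ * ∑ w, p k w * (-Real.log (S.len (List.ofFn w)))) ≤
          (n k : ℝ)⁻¹ * ∑ w, Real.negMulLog (p k w) := by
        have := mul_le_mul_of_nonneg_left hE hni
        calc _ = (n k : ℝ)⁻¹ * (t * ∑ w, p k w * (-Real.log (S.len (List.ofFn w)))) := by ring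
          _ ≤ _ := this
      calc (q:ℝ) * (t * (∑ w, p k w * birkhoff shift S.g (n k) (x k w) - ε1))
          ≤ q * (t * ((n k : ℝ)⁻¹ * ∑ w, p k w * (-Real.log (S.len (List.ofFn w))))) := by
            gcongr
        _ ≤ q * ((n k : ℝ)⁻¹ * ∑ w, Real.negMulLog (p k w)) := by gcongr
        _ = _ := by ring
    -- let ε1, δ → 0
    refine le_of_forall_pos_le_add fun η hη => ?_
    have h3 := hstep (η / (2 * q * t)) (by positivity) (1 - Real.exp (-(η / 2)))
      (by
        have : Real.exp (-(η / 2)) < 1 := by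
          rw [← Real.exp_zero]; exact Real.exp_lt_exp.2 (by linarith)
        linarith)
      (by have := Real.exp_pos (-(η / 2)); linarith)
    rw [sub_sub_cancel, Real.log_exp] at h3
    have h4 : (q:ℝ) * (t * (S.lyapSymb μ - η / (2 * q * t))) = q * (t * S.lyapSymb μ) - η / 2 := by
      field_simp
    rw [h4] at h3
    have h5 : ((q' : ℝ) + 1) = q := by rw [hq]; push_cast; ring
    rw [h5]
    linarith
  linarith


lemma dim_piece (S : PCSystem m) {d : ℕ} (f : SymbSp m → EuclideanSpace ℝ (Fin d))
    (α : EuclideanSpace ℝ (Fin d)) {t : NNReal} {c ε : ℝ} (ht : 0 < t) {N : ℕ}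
    (hN : ∀ n ≥ N, ∑ w, (goodW S f α c ε n).indicator
      (fun w => S.len (List.ofFn w) ^ (t : ℝ)) w ≤ 1) (N' : ℕ) :
    dimH (S.code '' {ω | ∀ n ≥ N', ‖birkhoff shift f n ω - α‖ ≤ ε ∧ c ≤ birkhoff shift S.g n ω})
      ≤ t := by
  classical
  refine dimH_le_of_hausdorffMeasure_ne_top (ne_of_lt (lt_of_le_of_lt ?_ ENNReal.one_lt_top))
  have ht' : (0:ℝ) < t := ht
  have hr : ∀ j : ℕ, ∃ M, ∀ w : List (Fin m), M ≤ w.length → S.len w < 1 / ((j : ℝ) + 1) :=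
    fun j => S.len_small (by positivity)
  choose M hM using hr
  let n : ℕ → ℕ := fun j => max (M j) (max N N')
  have hr0 : Tendsto (fun j : ℕ => ENNReal.ofReal (1 / ((j : ℝ) + 1))) atTop (𝓝 0) := by
    rw [← ENNReal.ofReal_zero]
    exact ENNReal.tendsto_ofReal tendsto_one_div_add_atTop_nhds_zero_nat
  refine (Measure.hausdorffMeasure_le_liminf_sum (ι := fun j => (Fin (n j) → Fin m)) (t : ℝ) _
    (fun j : ℕ => ENNReal.ofReal (1 / ((j : ℝ) + 1))) hr0
    (fun j w => if w ∈ goodW S f α c ε (n j) then S.cyl (List.ofFn w) else ∅) ?_ ?_).trans ?_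
  · refine Eventually.of_forall fun j w => ?_
    split_ifs
    · rw [S.cyl_eq, Real.ediam_Icc]
      refine ENNReal.ofReal_le_ofReal (hM j _ ?_).le
      rw [List.length_ofFn]; exact le_max_left _ _
    · simp
  · refine Eventually.of_forall fun j => ?_
    rintro _ ⟨ω, hω, rfl⟩
    have h1 := hω (n j) ((le_max_right _ _).trans (le_max_right _ _))
    have h2 : pre (n j) ω ∈ goodW S f α c ε (n j) := ⟨ω, h1, rfl⟩
    refine mem_iUnion.2 ⟨pre (n j) ω, ?_⟩
    rw [if_pos h2]
    exact S.code_mem ω (n j)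
  · refine liminf_le_of_frequently_le (Frequently.of_forall fun j => ?_)
    have h1 := hN (n j) ((le_max_left _ _).trans (le_max_right _ _))
    calc _ = ∑ w, ENNReal.ofReal ((goodW S f α c ε (n j)).indicator
          (fun w => S.len (List.ofFn w) ^ (t : ℝ)) w) := by
          refine Finset.sum_congr rfl fun w _ => ?_
          by_cases h : w ∈ goodW S f α c ε (n j)
          · rw [if_pos h, indicator_of_mem h, S.cyl_eq, Real.ediam_Icc,
              ← ENNReal.ofReal_rpow_of_pos (S.len_pos _)]
            rfl
          · rw [if_neg h, indicator_of_notMem h]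
            simp [ht']
      _ = ENNReal.ofReal (∑ w, (goodW S f α c ε (n j)).indicator
          (fun w => S.len (List.ofFn w) ^ (t : ℝ)) w) :=
          (ENNReal.ofReal_sum_of_nonneg fun w _ =>
            indicator_nonneg (fun w _ => Real.rpow_nonneg (S.len_pos _).le _) w).symm
      _ ≤ 1 := by rw [← ENNReal.ofReal_one]; exact ENNReal.ofReal_le_ofReal h1

lemma upper_bound (S : PCSystem m) {d : ℕ} (f : SymbSp m → EuclideanSpace ℝ (Fin d))
    (hf : Continuous f) (α : EuclideanSpace ℝ (Fin d)) :
    dimH (S.code '' (symbLevelSet f α ∩ S.SigmaTilde)) ≤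
      ⨆ (μ : Measure (SymbSp m)) (_ : μ ∈ shiftInvMeasures m ∧ (∫ ω, f ω ∂μ) = α ∧
        0 < S.lyapSymb μ), ENNReal.ofReal (metricEntropy shift μ / S.lyapSymb μ) := by
  refine le_of_not_gt fun hlt => ?_
  obtain ⟨t, ht, ht2⟩ := ENNReal.lt_iff_exists_nnreal_btwn.1 hlt
  refine absurd ht2 (not_lt_of_ge ?_)
  have ht0 : 0 < t := by
    have := lt_of_le_of_lt (bot_le : (⊥ : ENNReal) ≤ _) ht
    rw [bot_eq_zero] at this
    exact_mod_cast this
  have hsup : ∀ μ : Measure (SymbSp m), IsProbabilityMeasure μ → μ.map shift = μ →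
      (∫ ω, f ω ∂μ) = α → 0 < S.lyapSymb μ → metricEntropy shift μ < t * S.lyapSymb μ := by
    intro μ h1 h2 h3 h4
    have h5 : ENNReal.ofReal (metricEntropy shift μ / S.lyapSymb μ) < t :=
      lt_of_le_of_lt (le_iSup₂ (f := fun (μ : Measure (SymbSp m)) (_ : μ ∈ shiftInvMeasures m ∧
        (∫ ω, f ω ∂μ) = α ∧ 0 < S.lyapSymb μ) =>
        ENNReal.ofReal (metricEntropy shift μ / S.lyapSymb μ)) μ ⟨⟨h1, h2⟩, h3, h4⟩) ht
    rw [← ENNReal.ofReal_coe_nnreal, ENNReal.ofReal_lt_ofReal_iff (by exact_mod_cast ht0),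
      div_lt_iff₀ h4] at h5
    exact h5
  have hk : ∀ k : ℕ, _ := fun k => upper_key S f hf α (t := (t : ℝ)) (c := 1 / ((k : ℝ) + 1))
    (by exact_mod_cast ht0) (by positivity) hsup
  choose ε hε N hN using hk
  have hsub : S.code '' (symbLevelSet f α ∩ S.SigmaTilde) ⊆ ⋃ k : ℕ, ⋃ N' : ℕ,
      S.code '' {ω | ∀ n ≥ N', ‖birkhoff shift f n ω - α‖ ≤ ε k ∧
        1 / ((k : ℝ) + 1) ≤ birkhoff shift S.g n ω} := by
    rintro _ ⟨ω, ⟨h1, h2⟩, rfl⟩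
    obtain ⟨k, hk⟩ := exists_nat_one_div_lt
      (show 0 < atTop.liminf (fun n => birkhoff shift S.g n ω) from h2)
    have h3 := eventually_lt_of_lt_liminf hk ⟨0, by
      refine eventually_map.2 (Eventually.of_forall fun n => ?_)
      rw [birkhoff_eq]
      exact mul_nonneg (by positivity) (Finset.sum_nonneg fun i _ => S.g_nonneg _)⟩
    have h4 : Tendsto (fun n => birkhoff shift f n ω) atTop (𝓝 α) := h1
    have h5 := (Metric.tendsto_nhds.1 h4 (ε k) (hε k))
    obtain ⟨N', hN'⟩ := eventually_atTop.1 (h3.and h5)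
    refine mem_iUnion₂.2 ⟨k, N', ω, fun n hn => ⟨?_, (hN' n hn).1.le⟩, rfl⟩
    rw [← dist_eq_norm]
    exact (hN' n hn).2.le
  refine (dimH_mono hsub).trans ?_
  rw [dimH_iUnion]
  refine iSup_le fun k => ?_
  rw [dimH_iUnion]
  exact iSup_le fun N' => dim_piece S f α ht0 (hN k) N'

end


/-! ### Block lengths -/

/-- total length of the first `K` blocks -/
def LL (K : ℕ) : ℕ := ∑ k ∈ Finset.range K, (k + 1)

lemma LL_succ (K : ℕ) : LL (K + 1) = LL K + (K + 1) := Finset.sum_range_succ _ _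

lemma LL_two (K : ℕ) : 2 * LL K = K * (K + 1) := by
  induction K with
  | zero => simp [LL]
  | succ K ih => rw [LL_succ, mul_add, ih]; ring

lemma LL_mono : StrictMono LL := strictMono_nat_of_lt_succ fun K => by rw [LL_succ]; omega

lemma LL_cast (K : ℕ) : (LL K : ℝ) = ∑ k ∈ Finset.range K, ((k : ℝ) + 1) := by
  simp [LL]

lemma LL_small {ε : ℝ} (hε : 0 < ε) : ∀ᶠ K : ℕ in atTop, (K : ℝ) + 1 ≤ ε * LL K := by
  obtain ⟨N, hN⟩ := exists_nat_gt (2 / ε)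
  filter_upwards [eventually_ge_atTop N] with K hK
  have h1 : (2 * LL K : ℝ) = K * (K + 1) := by exact_mod_cast LL_two K
  have h2 : (N : ℝ) ≤ K := by exact_mod_cast hK
  rw [div_lt_iff₀ hε] at hN
  have h3 : 2 ≤ K * ε := by nlinarith
  nlinarith [mul_le_mul_of_nonneg_right h3 (by positivity : (0:ℝ) ≤ (K:ℝ) + 1)]

lemma LL_tendsto : Tendsto LL atTop atTop := LL_mono.tendsto_atTop

/-- block containing position `i` -/
def blk (i : ℕ) : ℕ := Nat.findGreatest (fun k => LL k ≤ i) i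

lemma blk_le (i : ℕ) : LL (blk i) ≤ i :=
  Nat.findGreatest_spec (P := fun k => LL k ≤ i) (Nat.zero_le i) (by simp [LL])

lemma lt_blk (i : ℕ) : i < LL (blk i + 1) := by
  by_contra h
  push Not at h
  have h1 : blk i + 1 ≤ i := (LL_mono.id_le _).trans h
  have := Nat.le_findGreatest (P := fun k => LL k ≤ i) h1 h
  change blk i + 1 ≤ blk i at this
  omega

lemma blk_eq {i k : ℕ} (h1 : LL k ≤ i) (h2 : i < LL (k + 1)) : blk i = k := by
  have h3 := blk_le i
  have h4 := lt_blk i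
  have h5 : k < blk i + 1 := LL_mono.lt_iff_lt.1 (h1.trans_lt h4)
  have h6 : blk i < k + 1 := LL_mono.lt_iff_lt.1 (h3.trans_lt h2)
  omega

lemma blk_tendsto : Tendsto blk atTop atTop := by
  rw [tendsto_atTop]
  intro K
  filter_upwards [eventually_ge_atTop (LL K)] with i hi
  have := LL_mono.lt_iff_lt.1 (hi.trans_lt (lt_blk i))
  omega

section
variable {m : ℕ}

/-- concatenation of blocks -/
def Phi (x : ℕ → SymbSp m) : SymbSp m := fun i => x (blk i) (i - LL (blk i))

lemma Phi_apply (x : ℕ → SymbSp m) {k j : ℕ} (h : j ≤ k) : Phi x (LL k + j) = x k j := by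
  have : blk (LL k + j) = k := blk_eq (by omega) (by rw [LL_succ]; omega)
  simp [Phi, this]

lemma measurable_Phi : Measurable (Phi : (ℕ → SymbSp m) → SymbSp m) :=
  measurable_pi_lambda _ fun i => (measurable_pi_apply _).comp (measurable_pi_apply _)

lemma birkhoffSum_blocks (φ : SymbSp m → ℝ) (ω : SymbSp m) (K : ℕ) :
    birkhoffSum shift φ (LL K) ω =
      ∑ k ∈ Finset.range K, birkhoffSum shift φ (k + 1) (shift^[LL k] ω) := by
  induction K with
  | zero => simp [LL]
  | succ K ih => rw [LL_succ, birkhoffSum_add, ih, Finset.sum_range_succ]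

lemma birkhoffSum_abs {φ : SymbSp m → ℝ} {B : ℝ} (hB : ∀ ω, |φ ω| ≤ B) (n : ℕ) (ω : SymbSp m) :
    |birkhoffSum shift φ n ω| ≤ B * n := by
  calc |birkhoffSum shift φ n ω| ≤ ∑ k ∈ Finset.range n, |φ (shift^[k] ω)| :=
        Finset.abs_sum_le_sum_abs _ _
    _ ≤ ∑ k ∈ Finset.range n, B := Finset.sum_le_sum fun k _ => hB _
    _ = B * n := by simp [mul_comm]

lemma concat_tendsto (x : ℕ → SymbSp m) (φ : SymbSp m → ℝ) (hφ : Continuous φ) (c : ℝ)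
    (h : ∀ ε > 0, ∀ᶠ K : ℕ in atTop,
      |∑ k ∈ Finset.range K, (birkhoffSum shift φ (k + 1) (x k) - (k + 1) * c)| ≤ ε * LL K) :
    Tendsto (fun n => birkhoff shift φ n (Phi x)) atTop (𝓝 c) := by
  obtain ⟨B, hB0, hB⟩ := bdd_of_cont φ hφ
  have hblock : ∀ ε > 0, ∀ᶠ K : ℕ in atTop,
      |birkhoffSum shift φ (LL K) (Phi x) - LL K * c| ≤ ε * LL K := by
    intro ε hε
    obtain ⟨N, hN⟩ := sum_var φ hφ (ε := ε / 3) (by positivity)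
    obtain ⟨M, hM⟩ := exists_nat_gt (2 * B * LL N / (ε / 3))
    rw [div_lt_iff₀ (by positivity)] at hM
    filter_upwards [h (ε / 3) (by positivity), LL_tendsto.eventually_ge_atTop M,
      eventually_ge_atTop N] with K h1 h2 h3
    have h4 : |birkhoffSum shift φ (LL K) (Phi x) -
        ∑ k ∈ Finset.range K, birkhoffSum shift φ (k + 1) (x k)| ≤ 2 * B * LL N + ε / 3 * LL K := by
      rw [birkhoffSum_blocks, ← Finset.sum_sub_distrib]
      refine (Finset.abs_sum_le_sum_abs _ _).trans ?_
      have h5 : ∀ k ∈ Finset.range K, |birkhoffSum shift φ (k + 1) (shift^[LL k] (Phi x)) -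
          birkhoffSum shift φ (k + 1) (x k)| ≤
          (if k < N then 2 * B * (k + 1) else 0) + ε / 3 * (k + 1) := by
        intro k _
        split_ifs with hk
        · have b1 := abs_le.1 (birkhoffSum_abs hB (k + 1) (shift^[LL k] (Phi x)))
          have b2 := abs_le.1 (birkhoffSum_abs hB (k + 1) (x k))
          push_cast at b1 b2
          have : 0 ≤ ε / 3 * ((k : ℝ) + 1) := by positivity
          rw [abs_le]; constructor <;> linarith
        · have := hN (k + 1) (by omega) (shift^[LL k] (Phi x)) (x k) (fun i hi => by
            rw [shift_iter, add_comm, Phi_apply x (by omega)])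
          push_cast at this
          linarith
      refine (Finset.sum_le_sum h5).trans ?_
      rw [Finset.sum_add_distrib, ← Finset.mul_sum, ← LL_cast]
      gcongr
      rw [LL_cast, Finset.mul_sum, ← Finset.sum_filter]
      refine le_of_eq (Finset.sum_congr ?_ fun _ _ => rfl)
      ext k; simp; omega
    have h6 : ∑ k ∈ Finset.range K, (birkhoffSum shift φ (k + 1) (x k) - (k + 1) * c) =
        ∑ k ∈ Finset.range K, birkhoffSum shift φ (k + 1) (x k) - LL K * c := by
      rw [Finset.sum_sub_distrib, ← Finset.sum_mul, LL_cast]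
    rw [h6] at h1
    have h7 : (M : ℝ) ≤ LL K := by exact_mod_cast h2
    have h8 : (M : ℝ) * (ε / 3) ≤ LL K * (ε / 3) := by gcongr
    have a1 := abs_le.1 h1
    have a2 := abs_le.1 h4
    rw [abs_le]; constructor <;> linarith
  rw [Metric.tendsto_atTop']
  intro ε hε
  have hev : ∀ᶠ n : ℕ in atTop, 0 < n ∧
      |birkhoffSum shift φ (LL (blk n)) (Phi x) - LL (blk n) * c| ≤ ε / 4 * LL (blk n) ∧
      ((blk n : ℕ) : ℝ) + 1 ≤ ε / (4 * (B + |c| + 1)) * LL (blk n) :=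
    (eventually_gt_atTop 0).and ((blk_tendsto.eventually (hblock (ε / 4) (by positivity))).and
      (blk_tendsto.eventually (LL_small (ε := ε / (4 * (B + |c| + 1))) (by positivity))))
  obtain ⟨n0, hn0⟩ := eventually_atTop.1 hev
  refine ⟨n0, fun n hn => ?_⟩
  obtain ⟨hnp, h1, h2⟩ := hn0 n hn.le
  have hnr : (0:ℝ) < n := by exact_mod_cast hnp
  rw [Real.dist_eq, birkhoff_eq]
  have h3 : (n : ℝ)⁻¹ * birkhoffSum shift φ n (Phi x) - c =
      (n : ℝ)⁻¹ * (birkhoffSum shift φ n (Phi x) - n * c) := by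
    field_simp
  rw [h3, abs_mul, abs_of_pos (inv_pos.2 hnr), inv_mul_lt_iff₀ hnr]
  obtain ⟨j, hj⟩ := Nat.exists_eq_add_of_le (blk_le n)
  have hj2 : j ≤ blk n := by
    have := lt_blk n; rw [LL_succ] at this; omega
  have h4 : birkhoffSum shift φ n (Phi x) = birkhoffSum shift φ (LL (blk n)) (Phi x) +
      birkhoffSum shift φ j (shift^[LL (blk n)] (Phi x)) := by
    rw [← birkhoffSum_add, ← hj]
  have h5 := birkhoffSum_abs hB j (shift^[LL (blk n)] (Phi x))
  have hnj : (n : ℝ) = LL (blk n) + j := by exact_mod_cast hj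
  have hj3 : (j : ℝ) ≤ blk n := by exact_mod_cast hj2
  have hC : 0 < B + |c| + 1 := by positivity
  have h6 : (B + |c|) * j ≤ ε / 4 * LL (blk n) := by
    calc (B + |c|) * j ≤ (B + |c| + 1) * (ε / (4 * (B + |c| + 1)) * LL (blk n)) := by
          refine mul_le_mul (by linarith) (by linarith) (by positivity) hC.le
      _ = _ := by field_simp
  have h7 : (LL (blk n) : ℝ) ≤ n := by exact_mod_cast blk_le n
  have h8 : |birkhoffSum shift φ n (Phi x) - n * c| ≤ ε / 4 * LL (blk n) + (B + |c|) * j := by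
    rw [h4]
    have e : birkhoffSum shift φ (LL (blk n)) (Phi x) +
        birkhoffSum shift φ j (shift^[LL (blk n)] (Phi x)) - n * c =
        (birkhoffSum shift φ (LL (blk n)) (Phi x) - LL (blk n) * c) +
        (birkhoffSum shift φ j (shift^[LL (blk n)] (Phi x)) - j * c) := by rw [hnj]; ring
    rw [e]
    refine (abs_add_le _ _).trans (add_le_add h1 ((abs_sub _ _).trans ?_))
    rw [abs_mul, Nat.abs_cast, add_mul, mul_comm |c|]
    exact add_le_add h5 le_rfl
  have h9 : ε / 4 * LL (blk n) ≤ ε / 4 * n := by gcongr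
  have h10 : 0 < ε * n := by positivity
  linarith

/-! ### Law of large numbers -/

/-- the product measure -/
def PP (μ : Measure (SymbSp m)) : Measure (ℕ → SymbSp m) := Measure.infinitePi (fun _ => μ)

instance (μ : Measure (SymbSp m)) [IsProbabilityMeasure μ] : IsProbabilityMeasure (PP μ) := by
  unfold PP; infer_instance

lemma lln_one (μ : Measure (SymbSp m)) [IsProbabilityMeasure μ] (Z : ℕ → SymbSp m → ℝ)
    (hZ : ∀ k, Measurable (Z k)) {C : ℝ} (hC : 0 < C) (hb : ∀ k ω, |Z k ω| ≤ C * (k + 1))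
    {ε : ℝ} (hε : 0 < ε) :
    ∀ᵐ x ∂(PP μ), ∀ᶠ K : ℕ in atTop,
      ∑ k ∈ Finset.range K, (Z k (x k) - ∫ ω, Z k ω ∂μ) ≤ ε * LL K := by
  have hind := ProbabilityTheory.iIndepFun_infinitePi (P := fun _ : ℕ => μ)
    (X := fun k ω => Z k ω - ∫ ω, Z k ω ∂μ) (fun k => (hZ k).sub_const _)
  have hev : ∀ k, MeasurePreserving (Function.eval k) (PP μ) μ := fun k =>
    measurePreserving_eval_infinitePi (fun _ : ℕ => μ) k
  have hsub : ∀ k, ProbabilityTheory.HasSubgaussianMGF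
      (fun x : ℕ → SymbSp m => Z k (x k) - ∫ ω, Z k ω ∂μ)
      ((‖C * ((k:ℝ) + 1) - -(C * ((k:ℝ) + 1))‖₊ / 2) ^ 2) (PP μ) := by
    intro k
    have h1 := ProbabilityTheory.hasSubgaussianMGF_of_mem_Icc (μ := PP μ)
      (X := fun x : ℕ → SymbSp m => Z k (x k)) (a := -(C * ((k:ℝ) + 1))) (b := C * ((k:ℝ) + 1))
      ((hZ k).comp (measurable_pi_apply k)).aemeasurable
      (Eventually.of_forall fun x => abs_le.1 (hb k (x k)))
    have h2 : ∫ x, Z k (x k) ∂(PP μ) = ∫ ω, Z k ω ∂μ := by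
      have := integral_map (μ := PP μ) (φ := Function.eval k) (f := Z k)
        (hev k).measurable.aemeasurable (hZ k).aestronglyMeasurable
      rw [(hev k).map_eq] at this
      exact this.symm
    rwa [h2] at h1
  have hbound : ∀ K : ℕ, (PP μ).real {x | ε * LL K ≤
      ∑ k ∈ Finset.range K, (Z k (x k) - ∫ ω, Z k ω ∂μ)} ≤ Real.exp (-(ε ^ 2 / (8 * C ^ 2))) ^ K := by
    intro K
    have h1 := ProbabilityTheory.HasSubgaussianMGF.measure_sum_ge_le_of_iIndepFun hind
      (s := Finset.range K) (fun k _ => hsub k) (ε := ε * LL K) (by positivity)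
    refine h1.trans ?_
    rw [← Real.exp_nat_mul]
    refine Real.exp_le_exp.2 ?_
    rcases Nat.eq_zero_or_pos K with rfl | hK
    · simp [LL]
    have hKr : (0:ℝ) < K := by exact_mod_cast hK
    have h2 : ((∑ k ∈ Finset.range K, (‖C * ((k:ℝ) + 1) - -(C * ((k:ℝ) + 1))‖₊ / 2) ^ 2 : NNReal) : ℝ)
        ≤ C ^ 2 * K ^ 3 := by
      push_cast
      calc ∑ k ∈ Finset.range K, (‖C * ((k:ℝ) + 1) - -(C * ((k:ℝ) + 1))‖ / 2) ^ 2
          ≤ ∑ k ∈ Finset.range K, C ^ 2 * K ^ 2 := by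
            refine Finset.sum_le_sum fun k hk => ?_
            rw [Finset.mem_range] at hk
            have : (k : ℝ) + 1 ≤ K := by exact_mod_cast hk
            rw [sub_neg_eq_add, ← two_mul, Real.norm_of_nonneg (by positivity),
              mul_div_cancel_left₀ _ (by norm_num : (2:ℝ) ≠ 0), mul_pow]
            gcongr
        _ = _ := by simp; ring
    have h3 : 0 < ((∑ k ∈ Finset.range K, (‖C * ((k:ℝ) + 1) - -(C * ((k:ℝ) + 1))‖₊ / 2) ^ 2 : NNReal) : ℝ) := by
      push_cast
      refine Finset.sum_pos (fun k _ => ?_) ⟨0, by simpa using hK⟩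
      rw [sub_neg_eq_add, ← two_mul, Real.norm_of_nonneg (by positivity)]
      positivity
    have h4 : (2 * LL K : ℝ) = K * (K + 1) := by exact_mod_cast LL_two K
    have h5 : (K:ℝ) ^ 2 / 2 ≤ LL K := by nlinarith
    rw [neg_div, mul_neg, neg_le_neg_iff, le_div_iff₀ (by positivity)]
    calc (K:ℝ) * (ε ^ 2 / (8 * C ^ 2)) * (2 * _) ≤ (K:ℝ) * (ε ^ 2 / (8 * C ^ 2)) * (2 * (C ^ 2 * K ^ 3)) := by
          gcongr
      _ = (ε * (K ^ 2 / 2)) ^ 2 := by field_simp; ring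
      _ ≤ _ := by gcongr
  have hsum : ∑' K : ℕ, (PP μ) {x | ε * LL K ≤
      ∑ k ∈ Finset.range K, (Z k (x k) - ∫ ω, Z k ω ∂μ)} ≠ ⊤ := by
    have hlt : Real.exp (-(ε ^ 2 / (8 * C ^ 2))) < 1 := by
      rw [← Real.exp_zero]; exact Real.exp_lt_exp.2 (neg_lt_zero.2 (by positivity))
    have hs := summable_geometric_of_lt_one (Real.exp_pos _).le hlt
    refine ne_top_of_le_ne_top hs.tsum_ofReal_ne_top (ENNReal.tsum_le_tsum fun K => ?_)
    rw [← ofReal_measureReal]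
    exact ENNReal.ofReal_le_ofReal (hbound K)
  filter_upwards [ae_eventually_notMem hsum] with x hx
  filter_upwards [hx] with K hK
  exact (not_le.1 hK).le


lemma lln (μ : Measure (SymbSp m)) [IsProbabilityMeasure μ] (Z : ℕ → SymbSp m → ℝ)
    (hZ : ∀ k, Measurable (Z k)) {C : ℝ} (hC : 0 < C) (hb : ∀ k ω, |Z k ω| ≤ C * (k + 1)) :
    ∀ᵐ x ∂(PP μ), ∀ ε > 0, ∀ᶠ K : ℕ in atTop,
      |∑ k ∈ Finset.range K, (Z k (x k) - ∫ ω, Z k ω ∂μ)| ≤ ε * LL K := by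
  have h1 : ∀ j : ℕ, ∀ᵐ x ∂(PP μ), ∀ᶠ K : ℕ in atTop,
      |∑ k ∈ Finset.range K, (Z k (x k) - ∫ ω, Z k ω ∂μ)| ≤ 1 / ((j:ℝ) + 1) * LL K := by
    intro j
    have hj : 0 < 1 / ((j:ℝ) + 1) := by positivity
    filter_upwards [lln_one μ Z hZ hC hb hj, lln_one μ (fun k ω => -Z k ω) (fun k => (hZ k).neg) hC
      (fun k ω => by rw [abs_neg]; exact hb k ω) hj] with x h1 h2
    filter_upwards [h1, h2] with K h3 h4
    rw [abs_le]
    refine ⟨?_, h3⟩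
    have e : ∑ k ∈ Finset.range K, (-Z k (x k) - ∫ ω, -Z k ω ∂μ) =
        -∑ k ∈ Finset.range K, (Z k (x k) - ∫ ω, Z k ω ∂μ) := by
      rw [← Finset.sum_neg_distrib]
      refine Finset.sum_congr rfl fun k _ => ?_
      rw [integral_neg]; ring
    rw [e] at h4
    linarith
  filter_upwards [ae_all_iff.2 h1] with x hx ε hε
  obtain ⟨j, hj⟩ := exists_nat_one_div_lt hε
  filter_upwards [hx j] with K hK
  exact hK.trans (by gcongr)

lemma ae_birkhoff {μ : Measure (SymbSp m)} [IsProbabilityMeasure μ] (hμ : μ.map shift = μ)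
    (φ : SymbSp m → ℝ) (hφ : Continuous φ) :
    ∀ᵐ x ∂(PP μ), Tendsto (fun n => birkhoff shift φ n (Phi x)) atTop (𝓝 (∫ ω, φ ω ∂μ)) := by
  obtain ⟨B, hB0, hB⟩ := bdd_of_cont φ hφ
  have hc : ∀ n, Continuous (fun ω : SymbSp m => birkhoffSum shift φ n ω) := fun n =>
    continuous_finsetSum _ fun i _ => hφ.comp (continuous_shift.iterate i)
  have hinteg : ∀ n, ∫ ω, birkhoffSum shift φ n ω ∂μ = n * ∫ ω, φ ω ∂μ := by
    intro n
    simp only [birkhoffSum]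
    rw [integral_finsetSum _ fun i _ => integrable_cont μ (fun ω => φ (shift^[i] ω))
      (hφ.comp (continuous_shift.iterate i))]
    simp_rw [int_shift hμ φ (integrable_cont μ φ hφ).aestronglyMeasurable]
    simp
  have h := lln μ (fun k ω => birkhoffSum shift φ (k + 1) ω) (fun k => (hc _).measurable)
    (C := B + 1) (by positivity) (fun k ω => by
      have := birkhoffSum_abs hB (k + 1) ω
      push_cast at this
      nlinarith)
  filter_upwards [h] with x hx
  refine concat_tendsto x φ hφ _ fun ε hε => ?_
  filter_upwards [hx ε hε] with K hK
  simp_rw [hinteg] at hK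
  push_cast at hK
  exact hK

/-- truncated information function -/
def info (μ : Measure (SymbSp m)) (k : ℕ) (ω : SymbSp m) : ℝ :=
  -Real.log (max (μ.real (pre (k + 1) ⁻¹' {pre (k + 1) ω})) ((m : ℝ) ^ (k + 1))⁻¹)

lemma info_meas (μ : Measure (SymbSp m)) (k : ℕ) : Measurable (info μ k) := by
  have : info μ k = (fun w => -Real.log (max (μ.real (pre (k + 1) ⁻¹' {w})) ((m : ℝ) ^ (k + 1))⁻¹)) ∘
      (pre (k + 1)) := rfl
  rw [this]
  exact (measurable_of_countable _).comp (measurable_pre _)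

lemma info_abs (hm : 0 < m) (μ : Measure (SymbSp m)) [IsProbabilityMeasure μ] (k : ℕ)
    (ω : SymbSp m) : |info μ k ω| ≤ (Real.log m + 1) * (k + 1) := by
  have hmR : (1:ℝ) ≤ m := by exact_mod_cast hm
  have hpow : (0:ℝ) < (m : ℝ) ^ (k + 1) := by positivity
  set y := max (μ.real (pre (k + 1) ⁻¹' {pre (k + 1) ω})) ((m : ℝ) ^ (k + 1))⁻¹ with hy
  have h1 : ((m : ℝ) ^ (k + 1))⁻¹ ≤ y := le_max_right _ _
  have h2 : y ≤ 1 := max_le measureReal_le_one (inv_le_one_of_one_le₀ (one_le_pow₀ hmR))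
  have h3 := Real.log_le_log (inv_pos.2 hpow) h1
  rw [Real.log_inv, Real.log_pow] at h3
  have hy0 : 0 < y := (inv_pos.2 hpow).trans_le h1
  have h4 := Real.log_nonpos hy0.le h2
  have h5 : info μ k ω = -Real.log y := rfl
  have h6 := Real.log_nonneg hmR
  push_cast at h3
  rw [h5, abs_le]
  have h7 : (0:ℝ) ≤ k := Nat.cast_nonneg k
  constructor <;> nlinarith

lemma info_int (hm : 0 < m) (μ : Measure (SymbSp m)) [IsProbabilityMeasure μ] (k : ℕ) :
    Hc μ (k + 1) - 1 ≤ ∫ ω, info μ k ω ∂μ := by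
  have hmR : (0:ℝ) < m := by exact_mod_cast hm
  have hpow : (0:ℝ) < (m : ℝ) ^ (k + 1) := by positivity
  have e := (fin_int μ (pre (k + 1)) (meas_pre (k + 1))
    (fun w => -Real.log (max (μ.real (pre (k + 1) ⁻¹' {w})) ((m : ℝ) ^ (k + 1))⁻¹))).2
  change ∫ ω, info μ k ω ∂μ = _ at e
  rw [e, Hc, sub_le_iff_le_add]
  have h1 : (1:ℝ) = ∑ w : Fin (k + 1) → Fin m, ((m : ℝ) ^ (k + 1))⁻¹ := by
    simp only [Finset.sum_const, Finset.card_univ, Fintype.card_fun, Fintype.card_fin, nsmul_eq_mul,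
      Nat.cast_pow]
    rw [mul_inv_cancel₀ hpow.ne']
  rw [h1, ← Finset.sum_add_distrib]
  refine Finset.sum_le_sum fun w _ => ?_
  set p := μ.real (pre (k + 1) ⁻¹' {w}) with hp
  set M := (m : ℝ) ^ (k + 1) with hM
  have hMi : 0 < M⁻¹ := inv_pos.2 hpow
  rcases le_total M⁻¹ p with h | h
  · rw [max_eq_left h, Real.negMulLog]; linarith
  · rw [max_eq_right h, Real.negMulLog]
    rcases (measureReal_nonneg (μ := μ) (s := pre (k + 1) ⁻¹' {w})).eq_or_lt with h0 | h0
    · rw [← hp] at h0; rw [← h0]; simp; exact hpow.le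
    · rw [← hp] at h0
      have h2 := Real.log_le_sub_one_of_pos (div_pos hMi h0)
      rw [Real.log_div hMi.ne' h0.ne'] at h2
      have h3 := mul_le_mul_of_nonneg_left h2 h0.le
      rw [mul_sub, mul_sub, mul_div_cancel₀ _ h0.ne'] at h3
      linarith

lemma cyl_meas_le (hm : 0 < m) (μ : Measure (SymbSp m)) [IsProbabilityMeasure μ]
    (x : ℕ → SymbSp m) (K : ℕ) :
    PP μ {y | pre (LL K) (Phi y) = pre (LL K) (Phi x)} ≤
      ENNReal.ofReal (Real.exp (-∑ k ∈ Finset.range K, info μ k (x k))) := by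
  have hmR : (0:ℝ) < m := by exact_mod_cast hm
  have hsub : {y : ℕ → SymbSp m | pre (LL K) (Phi y) = pre (LL K) (Phi x)} ⊆
      ((Finset.range K : Finset ℕ) : Set ℕ).pi (fun k => pre (k + 1) ⁻¹' {pre (k + 1) (x k)}) := by
    intro y hy k hk
    have hk' : k < K := by simpa using hk
    change pre (k + 1) (y k) = pre (k + 1) (x k)
    funext j
    have hj : (j : ℕ) ≤ k := by have := j.2; omega
    have hlt : LL k + j < LL K := by
      have : LL (k + 1) ≤ LL K := LL_mono.monotone hk'
      rw [LL_succ] at this; omega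
    have h1 : Phi y (LL k + j) = Phi x (LL k + j) := congrFun hy ⟨LL k + j, hlt⟩
    rwa [Phi_apply y hj, Phi_apply x hj] at h1
  refine (measure_mono hsub).trans ?_
  unfold PP
  rw [Measure.infinitePi_pi _ (fun k _ => meas_pre _ _), ← Finset.sum_neg_distrib, Real.exp_sum,
    ENNReal.ofReal_prod_of_nonneg (fun k _ => (Real.exp_pos _).le)]
  refine Finset.prod_le_prod' fun k _ => ?_
  rw [← ofReal_measureReal]
  refine ENNReal.ofReal_le_ofReal ?_
  rw [info, neg_neg, Real.exp_log (lt_max_of_lt_right (by positivity))]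
  exact le_max_left _ _

lemma ae_entropy (hm : 0 < m) {μ : Measure (SymbSp m)} [IsProbabilityMeasure μ]
    (hμ : μ.map shift = μ) {ε : ℝ} (hε : 0 < ε) :
    ∀ᵐ x ∂(PP μ), ∀ᶠ K : ℕ in atTop,
      PP μ {y | pre (LL K) (Phi y) = pre (LL K) (Phi x)} ≤
        ENNReal.ofReal (Real.exp (-(LL K * (metricEntropy shift μ - ε)))) := by
  have hmR : (1:ℝ) ≤ m := by exact_mod_cast hm
  have hl := Real.log_nonneg hmR
  filter_upwards [lln μ (info μ) (info_meas μ) (C := Real.log m + 1) (by positivity)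
    (info_abs hm μ)] with x hx
  filter_upwards [hx (ε / 2) (by positivity), LL_small (ε := ε / 2) (by positivity)] with K h1 h2
  refine (cyl_meas_le hm μ x K).trans (ENNReal.ofReal_le_ofReal (Real.exp_le_exp.2 ?_))
  rw [neg_le_neg_iff]
  have h3 : ∀ k : ℕ, ((k:ℝ) + 1) * metricEntropy shift μ - 1 ≤ ∫ ω, info μ k ω ∂μ := by
    intro k
    have h4 := entropy_le hm hμ (N := k + 1) (Nat.succ_pos k)
    rw [le_div_iff₀ (by positivity)] at h4
    push_cast at h4
    have := info_int hm μ k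
    linarith
  have h5 : ∑ k ∈ Finset.range K, (((k:ℝ) + 1) * metricEntropy shift μ - 1) ≤
      ∑ k ∈ Finset.range K, ∫ ω, info μ k ω ∂μ := Finset.sum_le_sum fun k _ => h3 k
  rw [Finset.sum_sub_distrib, ← Finset.sum_mul, ← LL_cast] at h5
  simp only [Finset.sum_const, Finset.card_range, nsmul_eq_mul, mul_one] at h5
  rw [Finset.sum_sub_distrib] at h1
  have h6 := (abs_le.1 h1).1
  linarith

end

section lower
variable {m : ℕ}

lemma count_words (S : PCSystem m) {n : ℕ} (U : Set ℝ) (W : Finset (Fin n → Fin m)) {l r : ℝ}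
    (hr : 0 ≤ r) (hl : 0 ≤ l) (hU : ∀ u ∈ U, ∀ v ∈ U, |u - v| ≤ r)
    (hW : ∀ w ∈ W, (∃ u ∈ U, u ∈ S.cyl (List.ofFn w)) ∧ l ≤ S.len (List.ofFn w) ∧
      S.len (List.ofFn w) ≤ r) : (W.card : ℝ) * l ≤ 4 * r := by
  rcases W.eq_empty_or_nonempty with rfl | ⟨w0, hw0⟩
  · simp; positivity
  obtain ⟨⟨u0, hu0, _⟩, _⟩ := hW w0 hw0
  have hsub : (⋃ w ∈ W, S.cyl (List.ofFn w)) ⊆ Icc (u0 - 2 * r) (u0 + 2 * r) := by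
    refine iUnion₂_subset fun w hw y hy => ?_
    obtain ⟨⟨u, hu, huc⟩, _, h2⟩ := hW w hw
    have h3 := abs_le.1 (hU u hu u0 hu0)
    have h4 := abs_le.1 ((S.abs_sub_le_len hy huc).trans h2)
    constructor <;> linarith [h3.1, h3.2, h4.1, h4.2]
  have hdis : (W : Set (Fin n → Fin m)).PairwiseDisjoint (fun w => S.cyl (List.ofFn w)) := by
    intro w _ w' _ hne
    obtain ⟨ω, rfl⟩ := exists_ext S.hm w
    obtain ⟨ω', rfl⟩ := exists_ext S.hm w'
    exact S.cyl_disjoint n ω ω' fun h => hne (List.ofFn_injective h)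
  have hmeas : ∀ w ∈ W, MeasurableSet (S.cyl (List.ofFn w)) := fun w _ => by
    rw [S.cyl_eq]; exact measurableSet_Icc
  have h1 := measure_mono (μ := volume) hsub
  rw [measure_biUnion_finset hdis hmeas, Real.volume_Icc] at h1
  have h2 : ∑ w ∈ W, ENNReal.ofReal l ≤ ∑ w ∈ W, volume (S.cyl (List.ofFn w)) := by
    refine Finset.sum_le_sum fun w hw => ?_
    rw [S.cyl_eq, Real.volume_Icc]
    exact ENNReal.ofReal_le_ofReal (hW w hw).2.1
  have h3 := h2.trans h1
  rw [← ENNReal.ofReal_sum_of_nonneg (fun _ _ => hl),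
    ENNReal.ofReal_le_ofReal_iff (by linarith), Finset.sum_const, nsmul_eq_mul] at h3
  linarith

lemma ball_bound (S : PCSystem m) (μ : Measure (SymbSp m)) [IsProbabilityMeasure μ]
    {lam h ε s : ℝ} (hε : 0 < ε) (hε' : ε < lam) (hs : 0 < s)
    (hc : s * lam + 3 * ε + ε * lam ≤ h) (A : Set (ℕ → SymbSp m)) (K0 : ℕ)
    (hA : ∀ x ∈ A, ∀ K ≥ K0,
      PP μ {y | pre (LL K) (Phi y) = pre (LL K) (Phi x)} ≤
        ENNReal.ofReal (Real.exp (-(LL K * (h - ε)))) ∧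
      Real.exp (-(LL K * (lam + ε))) ≤ S.len (word (Phi x) (LL K)) ∧
      S.len (word (Phi x) (LL K)) ≤ Real.exp (-(LL K * (lam - ε)))) :
    ∃ r0 > 0, ∀ r : ℝ, 0 < r → r < r0 → ∀ U : Set ℝ, (∀ u ∈ U, ∀ v ∈ U, |u - v| ≤ r) →
      PP μ {x | x ∈ A ∧ S.code (Phi x) ∈ U} ≤ ENNReal.ofReal (4 * r ^ s) := by
  classical
  obtain ⟨K1, hK1⟩ := eventually_atTop.1 ((LL_small hε).and (eventually_ge_atTop K0))
  refine ⟨Real.exp (-(LL (K1 + 1) * (lam - ε))), Real.exp_pos _, fun r hr hr0 U hU => ?_⟩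
  have hd : 0 < lam - ε := by linarith
  have hex : ∃ K : ℕ, Real.exp (-(LL K * (lam - ε))) ≤ r := by
    have h1 : Tendsto (fun K : ℕ => Real.exp (-((LL K : ℝ) * (lam - ε)))) atTop (𝓝 0) := by
      refine Real.tendsto_exp_neg_atTop_nhds_zero.comp ?_
      exact (tendsto_natCast_atTop_atTop.comp LL_tendsto).atTop_mul_const hd
    exact (h1.eventually (ge_mem_nhds hr)).exists
  obtain ⟨K, hK, hKmin⟩ : ∃ K : ℕ, Real.exp (-(LL K * (lam - ε))) ≤ r ∧
      ∀ J < K, r < Real.exp (-(LL J * (lam - ε))) :=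
    ⟨Nat.find hex, Nat.find_spec hex, fun J hJ => not_le.1 (Nat.find_min hex hJ)⟩
  have hKK : K1 + 1 < K := by
    by_contra hcon
    have h1 : (LL K : ℝ) ≤ LL (K1 + 1) := by exact_mod_cast LL_mono.monotone (not_lt.1 hcon)
    have h2 : Real.exp (-(LL (K1 + 1) * (lam - ε))) ≤ Real.exp (-(LL K * (lam - ε))) := by
      apply Real.exp_le_exp.2
      nlinarith
    linarith
  obtain ⟨J, rfl⟩ : ∃ J, K = J + 1 := ⟨K - 1, by omega⟩
  have hJ := (hK1 J (by omega)).1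
  have hrJ := hKmin J (by omega)
  have hLL : (LL (J + 1) : ℝ) = LL J + (J + 1) := by exact_mod_cast LL_succ J
  set L : ℝ := (LL (J + 1) : ℝ) with hL
  have hLJ0 : (0:ℝ) ≤ LL J := Nat.cast_nonneg _
  have hJ0 : (0:ℝ) ≤ J := Nat.cast_nonneg _
  have hL0 : 0 ≤ L := Nat.cast_nonneg _
  have hLJ : (1 - ε) * L ≤ LL J := by nlinarith
  have hr1 : r ≤ Real.exp (-(L * (lam - ε - ε * lam))) := by
    refine hrJ.le.trans (Real.exp_le_exp.2 ?_)
    have h1 := mul_le_mul_of_nonneg_right hLJ hd.le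
    have h2 : 0 ≤ L * ε ^ 2 := by positivity
    nlinarith
  let W : Finset (Fin (LL (J + 1)) → Fin m) :=
    Finset.univ.filter fun w => ∃ x ∈ A, S.code (Phi x) ∈ U ∧ pre (LL (J + 1)) (Phi x) = w
  have hJK : K0 ≤ J + 1 := (hK1 (J + 1) (by omega)).2
  have hcount : (W.card : ℝ) * Real.exp (-(L * (lam + ε))) ≤ 4 * r := by
    refine count_words S U W hr.le (Real.exp_pos _).le hU ?_
    intro w hw
    obtain ⟨x, hx, hxU, rfl⟩ := (Finset.mem_filter.1 hw).2
    obtain ⟨_, h2, h3⟩ := hA x hx (J + 1) hJK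
    exact ⟨⟨_, hxU, S.code_mem _ _⟩, h2, h3.trans hK⟩
  have hsub : {x | x ∈ A ∧ S.code (Phi x) ∈ U} ⊆
      ⋃ w ∈ W, {y | pre (LL (J + 1)) (Phi y) = w} := by
    rintro x ⟨hx, hxU⟩
    exact mem_iUnion₂.2 ⟨pre (LL (J + 1)) (Phi x),
      Finset.mem_filter.2 ⟨Finset.mem_univ _, x, hx, hxU, rfl⟩, rfl⟩
  have h1 : PP μ {x | x ∈ A ∧ S.code (Phi x) ∈ U} ≤
      ∑ w ∈ W, ENNReal.ofReal (Real.exp (-(L * (h - ε)))) := by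
    refine (measure_mono hsub).trans ((measure_biUnion_finset_le _ _).trans ?_)
    refine Finset.sum_le_sum fun w hw => ?_
    obtain ⟨x, hx, hxU, rfl⟩ := (Finset.mem_filter.1 hw).2
    exact (hA x hx (J + 1) hJK).1
  refine h1.trans ?_
  rw [← ENNReal.ofReal_sum_of_nonneg (fun _ _ => (Real.exp_pos _).le)]
  refine ENNReal.ofReal_le_ofReal ?_
  rw [Finset.sum_const, nsmul_eq_mul]
  have e1 : (W.card : ℝ) ≤ 4 * r * Real.exp (L * (lam + ε)) := by
    rw [Real.exp_neg, ← div_eq_mul_inv, div_le_iff₀ (Real.exp_pos _)] at hcount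
    exact hcount
  calc (W.card : ℝ) * Real.exp (-(L * (h - ε)))
      ≤ (4 * r * Real.exp (L * (lam + ε))) * Real.exp (-(L * (h - ε))) := by gcongr
    _ ≤ (4 * Real.exp (-(L * (lam - ε - ε * lam))) * Real.exp (L * (lam + ε))) *
        Real.exp (-(L * (h - ε))) := by gcongr
    _ = 4 * Real.exp (L * (3 * ε + ε * lam - h)) := by
        rw [mul_assoc, mul_assoc, ← Real.exp_add, ← Real.exp_add]; ring_nf
    _ ≤ 4 * Real.exp (-(L * (lam - ε)) * s) := by
        refine mul_le_mul_of_nonneg_left (Real.exp_le_exp.2 ?_) (by norm_num)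
        have : 0 ≤ L * (ε * s) := by positivity
        nlinarith [mul_le_mul_of_nonneg_left hc hL0]
    _ = 4 * Real.exp (-(L * (lam - ε))) ^ s := by rw [Real.exp_mul]
    _ ≤ 4 * r ^ s := by
        gcongr

lemma ae_len (S : PCSystem m) {μ : Measure (SymbSp m)} {ε : ℝ} (hε : 0 < ε) {ω : SymbSp m}
    (h : Tendsto (fun n => birkhoff shift S.g n ω) atTop (𝓝 (S.lyapSymb μ))) :
    ∀ᶠ n : ℕ in atTop, Real.exp (-(n * (S.lyapSymb μ + ε))) ≤ S.len (word ω n) ∧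
      S.len (word ω n) ≤ Real.exp (-(n * (S.lyapSymb μ - ε))) := by
  obtain ⟨N, hN⟩ := S.len_birkhoff (half_pos hε)
  filter_upwards [Metric.tendsto_nhds.1 h (ε / 2) (half_pos hε), eventually_ge_atTop N,
    eventually_gt_atTop 0] with n h1 h2 h3
  have h4 := abs_le.1 (hN n h2 ω)
  have h5 := abs_lt.1 (by rwa [Real.dist_eq] at h1)
  have hn : (0:ℝ) < n := by exact_mod_cast h3
  have h6 : birkhoffSum shift S.g n ω = n * birkhoff shift S.g n ω := by
    rw [birkhoff_eq]; field_simp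
  rw [h6] at h4
  rw [← Real.le_log_iff_exp_le (S.len_pos _), ← Real.log_le_iff_le_exp (S.len_pos _)]
  constructor <;> nlinarith [h4.1, h4.2, h5.1, h5.2]

theorem lower_bound (S : PCSystem m) {d : ℕ} (f : SymbSp m → EuclideanSpace ℝ (Fin d))
    (hf : Continuous f) (α : EuclideanSpace ℝ (Fin d)) (μ : Measure (SymbSp m))
    (hμ : μ ∈ shiftInvMeasures m) (hα : (∫ ω, f ω ∂μ) = α) (hlam : 0 < S.lyapSymb μ) :
    ENNReal.ofReal (metricEntropy shift μ / S.lyapSymb μ) ≤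
      dimH (S.code '' (symbLevelSet f α ∩ S.SigmaTilde)) := by
  obtain ⟨hprob, hinv⟩ := hμ
  by_contra hcon
  obtain ⟨s, hs1, hs2⟩ := ENNReal.lt_iff_exists_nnreal_btwn.1 (not_le.1 hcon)
  refine absurd hs1 (not_lt.2 ?_)
  have hs0 : (0:ℝ) < s := by
    have : (0 : ENNReal) < s := bot_le.trans_lt hs1
    exact_mod_cast this
  set lam := S.lyapSymb μ with hlam_def
  set h := metricEntropy shift μ with hh
  have hsl : (s:ℝ) * lam < h := by
    rw [← ENNReal.ofReal_coe_nnreal, ENNReal.ofReal_lt_ofReal_iff_of_nonneg hs0.le,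
      lt_div_iff₀ hlam] at hs2
    exact hs2
  obtain ⟨ε, hε, hε1, hε2⟩ : ∃ ε > 0, ε < lam ∧ s * lam + 3 * ε + ε * lam ≤ h := by
    refine ⟨min (lam / 2) ((h - s * lam) / (3 + lam)), ?_, ?_, ?_⟩
    · refine lt_min (by linarith) (div_pos (by linarith) (by linarith))
    · exact (min_le_left _ _).trans_lt (by linarith)
    · have := min_le_right (lam / 2) ((h - s * lam) / (3 + lam))
      rw [le_div_iff₀ (by linarith)] at this
      linarith
  let A : ℕ → Set (ℕ → SymbSp m) := fun K0 => {x | Phi x ∈ symbLevelSet f α ∩ S.SigmaTilde ∧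
    ∀ K ≥ K0, PP μ {y | pre (LL K) (Phi y) = pre (LL K) (Phi x)} ≤
        ENNReal.ofReal (Real.exp (-(LL K * (h - ε)))) ∧
      Real.exp (-(LL K * (lam + ε))) ≤ S.len (word (Phi x) (LL K)) ∧
      S.len (word (Phi x) (LL K)) ≤ Real.exp (-(LL K * (lam - ε)))}
  have hae : ∀ᵐ x ∂(PP μ), x ∈ ⋃ K0, A K0 := by
    have h1 : ∀ᵐ x ∂(PP μ), ∀ i : Fin d,
        Tendsto (fun n => birkhoff shift (fun ω => f ω i) n (Phi x)) atTop
          (𝓝 (∫ ω, f ω i ∂μ)) :=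
      ae_all_iff.2 fun i => ae_birkhoff hinv _ (by fun_prop)
    filter_upwards [h1, ae_birkhoff hinv S.g S.continuous_g, ae_entropy S.hm hinv hε]
      with x hx1 hx2 hx3
    have hx4 := LL_tendsto.eventually (ae_len S (μ := μ) hε hx2)
    obtain ⟨K0, hK0⟩ := eventually_atTop.1 (hx3.and hx4)
    refine mem_iUnion.2 ⟨K0, ⟨?_, ?_⟩, fun K hK => ⟨(hK0 K hK).1, (hK0 K hK).2⟩⟩
    · change Tendsto (fun n => birkhoff shift f n (Phi x)) atTop (𝓝 α)
      have h2 : Tendsto (fun n => (WithLp.ofLp (birkhoff shift f n (Phi x)) : Fin d → ℝ)) atTop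
          (𝓝 (WithLp.ofLp α)) := by
        rw [tendsto_pi_nhds]
        intro i
        have := hx1 i
        rw [integral_proj μ f hf i, hα] at this
        simpa only [proj_birkhoff] using this
      have h3 := ((PiLp.continuous_toLp 2 (fun _ : Fin d => ℝ)).tendsto _).comp h2
      simpa [Function.comp_def] using h3
    · change 0 < atTop.liminf fun n => birkhoff shift S.g n (Phi x)
      rw [hx2.liminf_eq]
      exact hlam
  obtain ⟨K0, hK0⟩ : ∃ K0, PP μ (A K0) ≠ 0 := by
    by_contra hno
    push Not at hno
    have h1 : PP μ (⋃ K0, A K0) = 0 := measure_iUnion_null hno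
    have h2 : PP μ (⋃ K0, A K0)ᶜ = 0 := hae
    have h3 : PP μ univ ≤ 0 := by
      rw [← union_compl_self (⋃ K0, A K0)]
      exact (measure_union_le _ _).trans (by rw [h1, h2, add_zero])
    simp at h3
  obtain ⟨r0, hr0, hb⟩ := ball_bound S μ hε hε1 hs0 hε2 (A K0) K0 (fun x hx => hx.2)
  have hcm : Measurable (fun x : ℕ → SymbSp m => S.code (Phi x)) :=
    S.continuous_code.measurable.comp measurable_Phi
  let ν := ((PP μ).restrict (A K0)).map (fun x => S.code (Phi x))
  have hν : ∀ U : Set ℝ, Metric.ediam U ≤ ENNReal.ofReal (r0 / 2) →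
      ν U ≤ 4 * Metric.ediam U ^ (s:ℝ) := by
    intro U hU
    have hcl : Metric.ediam (closure U) = Metric.ediam U := Metric.ediam_closure U
    have hfin : Metric.ediam U ≠ ⊤ := (hU.trans_lt ENNReal.ofReal_lt_top).ne
    set D := (Metric.ediam U).toReal with hD
    have hD0 : 0 ≤ D := ENNReal.toReal_nonneg
    have hDr : D ≤ r0 / 2 := ENNReal.toReal_le_of_le_ofReal (by linarith) hU
    have hpair : ∀ u ∈ closure U, ∀ v ∈ closure U, |u - v| ≤ D := by
      intro u hu v hv
      have := Metric.edist_le_ediam_of_mem hu hv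
      rw [hcl, edist_dist, Real.dist_eq] at this
      exact (ENNReal.ofReal_le_iff_le_toReal hfin).1 this
    have hle : ν U ≤ PP μ {x | x ∈ A K0 ∧ S.code (Phi x) ∈ closure U} := by
      refine (measure_mono subset_closure).trans ?_
      have hmc : MeasurableSet (closure U) := isClosed_closure.measurableSet
      rw [Measure.map_apply hcm hmc, Measure.restrict_apply (hcm hmc)]
      exact measure_mono fun x hx => ⟨hx.2, hx.1⟩
    have hev : ∀ᶠ n : ℕ in atTop, ν U ≤ ENNReal.ofReal (4 * (D + 1 / ((n:ℝ) + 1)) ^ (s:ℝ)) := by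
      filter_upwards [tendsto_one_div_add_atTop_nhds_zero_nat.eventually
        (gt_mem_nhds (show (0:ℝ) < r0 / 2 by linarith))] with n hn
      have hp : (0:ℝ) < 1 / ((n:ℝ) + 1) := by positivity
      exact hle.trans (hb _ (by linarith) (by linarith) _
        fun u hu v hv => (hpair u hu v hv).trans (by linarith))
    have hlim : Tendsto (fun n : ℕ => ENNReal.ofReal (4 * (D + 1 / ((n:ℝ) + 1)) ^ (s:ℝ))) atTop
        (𝓝 (ENNReal.ofReal (4 * D ^ (s:ℝ)))) := by
      refine ENNReal.tendsto_ofReal (Tendsto.const_mul _ ?_)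
      have h1 : Tendsto (fun n : ℕ => D + 1 / ((n:ℝ) + 1)) atTop (𝓝 D) := by
        simpa using tendsto_one_div_add_atTop_nhds_zero_nat.const_add D
      exact ((Real.continuous_rpow_const hs0.le).tendsto D).comp h1
    refine (ge_of_tendsto hlim hev).trans (le_of_eq ?_)
    rw [ENNReal.ofReal_mul (by norm_num), ← ENNReal.ofReal_rpow_of_nonneg hD0 hs0.le, hD,
      ENNReal.ofReal_toReal hfin]
    norm_num
  have hH : ((4:ENNReal)⁻¹ • ν) ≤ Measure.hausdorffMeasure (s:ℝ) := by
    refine Measure.le_hausdorffMeasure _ _ (ENNReal.ofReal (r0 / 2)) (by simpa using hr0) ?_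
    intro U hU
    rw [Measure.smul_apply, smul_eq_mul]
    calc (4:ENNReal)⁻¹ * ν U ≤ 4⁻¹ * (4 * Metric.ediam U ^ (s:ℝ)) := by gcongr; exact hν U hU
      _ = Metric.ediam U ^ (s:ℝ) := by
        rw [← mul_assoc, ENNReal.inv_mul_cancel (by norm_num) (by norm_num), one_mul]
  refine le_dimH_of_hausdorffMeasure_ne_zero fun h0 => hK0 ?_
  have h1 := hH (S.code '' (symbLevelSet f α ∩ S.SigmaTilde))
  rw [h0, Measure.smul_apply, smul_eq_mul] at h1
  have h2 : ν (S.code '' (symbLevelSet f α ∩ S.SigmaTilde)) = 0 := by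
    have := le_antisymm h1 bot_le
    rcases mul_eq_zero.1 this with h | h
    · simp at h
    · exact h
  refine le_antisymm ?_ bot_le
  calc PP μ (A K0) ≤ PP μ ((fun x => S.code (Phi x)) ⁻¹'
        (S.code '' (symbLevelSet f α ∩ S.SigmaTilde)) ∩ A K0) :=
        measure_mono fun x hx => ⟨⟨_, hx.1, rfl⟩, hx⟩
    _ ≤ (PP μ).restrict (A K0) _ := Measure.le_restrict_apply _ _
    _ ≤ ν _ := Measure.le_map_apply hcm.aemeasurable _
    _ = 0 := h2

end lower

/-- **Theorem 1 (Statement 0).** For a continuous potential `f : Σ → ℝ^d` and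
`α ∈ L_f`, the Hausdorff dimension of `Π(X_α ∩ Σ̃)` equals the supremum of
`h(μ,σ)/λ(μ,σ)` over invariant measures `μ` with `∫ f dμ = α` and `λ(μ,σ) > 0`. -/
theorem statement0 {m d : ℕ} (S : PCSystem m)
    (f : SymbSp m → EuclideanSpace ℝ (Fin d)) (hf : Continuous f)
    (α : EuclideanSpace ℝ (Fin d))
    (hα : ∃ μ ∈ shiftInvMeasures m, (∫ ω, f ω ∂μ) = α) :
    dimH (S.code '' (symbLevelSet f α ∩ S.SigmaTilde)) =
      ⨆ (μ : Measure (SymbSp m)) (_ : μ ∈ shiftInvMeasures m ∧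
          (∫ ω, f ω ∂μ) = α ∧ 0 < S.lyapSymb μ),
        ENNReal.ofReal (metricEntropy shift μ / S.lyapSymb μ) := by
  exact le_antisymm (upper_bound S f hf α)
    (iSup₂_le fun μ hμ => lower_bound S f hf α μ hμ.1 hμ.2.1 hμ.2.2)
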